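/- Let g ∈ G be a hyperbolic element of infinite order. Then there exist constants λ > 0 and c ≥ 0 such that |gⁿ|_{X∪𝓗} ≥ λ|n| − c for every n ∈ ℤ; in particular, the cyclic subgroup ⟨g⟩ is quasi-isometrically embedded in (G, dist_{X∪𝓗}). Consequently, if g^k is conjugate to g^l in G for some k, l ∈ ℤ, then k = ±l. -/

import Mathlib

namespace RelHyp

variable {G : Type*} [Group G] {Λ : Type*}

/-- Length of a shortest word over the alphabet `S ∪ S⁻¹` representing `g`. -/
noncomputable def wordLength (S : Set G) (g : G) : ℕ :=
  sInf {n | ∃ w : List G, w.length = n ∧ (∀ x ∈ w, x ∈ S ∨ x⁻¹ ∈ S) ∧ w.prod = g}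

/-- The free product `F = (∗_λ H_λ) ∗ F(X)`. -/
abbrev RelFree (H : Λ → Subgroup G) (X : Set G) : Type _ :=
  Monoid.Coprod (Monoid.CoprodI fun l => ↥(H l)) (FreeGroup ↥X)

/-- The canonical homomorphism `ε : F → G`. -/
def relEps (H : Λ → Subgroup G) (X : Set G) : RelFree H X →* G :=
  Monoid.Coprod.lift (Monoid.CoprodI.lift fun l => (H l).subtype)
    (FreeGroup.lift fun x => (x : G))

/-- Letters of the alphabet `X ∪ 𝓗`, where `𝓗 = ⊔_λ (H̃_λ ∖ {1})`. -/
abbrev RelLetter (H : Λ → Subgroup G) (X : Set G) : Type _ :=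
  (Σ l : Λ, {h : ↥(H l) // h ≠ 1}) ⊕ (↥X × Bool)

/-- The image of a letter in the free product `F`. -/
def RelLetter.toF {H : Λ → Subgroup G} {X : Set G} : RelLetter H X → RelFree H X
  | Sum.inl ⟨_, h⟩ => Monoid.Coprod.inl (Monoid.CoprodI.of h.1)
  | Sum.inr (x, b) => Monoid.Coprod.inr (if b then FreeGroup.of x else (FreeGroup.of x)⁻¹)

/-- The element of `G` represented by a letter. -/
def RelLetter.val {H : Λ → Subgroup G} {X : Set G} : RelLetter H X → G
  | Sum.inl ⟨_, h⟩ => (h.1 : G)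
  | Sum.inr (x, b) => if b then (x : G) else (x : G)⁻¹

/-- The index `λ` such that the letter belongs to `H̃_λ`, if any. -/
def RelLetter.hIndex {H : Λ → Subgroup G} {X : Set G} : RelLetter H X → Option Λ
  | Sum.inl ⟨l, _⟩ => some l
  | Sum.inr _ => none

/-- The element of `F` represented by a word over `X ∪ 𝓗`. -/
def wordToF {H : Λ → Subgroup G} {X : Set G} (w : List (RelLetter H X)) : RelFree H X :=
  (w.map RelLetter.toF).prod

/-- `f` is a relative isoperimetric function of the relative presentation `⟨X, H | R⟩`. -/
def IsIsoperFn (H : Λ → Subgroup G) (X : Set G) (R : Set (RelFree H X)) (f : ℕ → ℕ) : Prop :=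
  ∀ w : List (RelLetter H X), relEps H X (wordToF w) = 1 →
    ∃ k ≤ f w.length, ∃ r c : Fin k → RelFree H X,
      (∀ i, r i ∈ R) ∧ wordToF w = (List.ofFn fun i => (c i)⁻¹ * r i * c i).prod

/-- `⟨X, H | R⟩` is a finite relative presentation of `G` w.r.t. the collection `H`. -/
structure IsFiniteRelPres (H : Λ → Subgroup G) (X : Set G) (R : Set (RelFree H X)) : Prop where
  finX : X.Finite
  finR : R.Finite
  surj : Function.Surjective (relEps H X)
  ker : (relEps H X).ker = Subgroup.normalClosure R

/-- `G` is finitely presented relative to the collection of subgroups `H`. -/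
def FinitelyPresentedRel (H : Λ → Subgroup G) : Prop :=
  ∃ (X : Set G) (R : Set (RelFree H X)), IsFiniteRelPres H X R

/-- The relative area of a word representing `1`. -/
noncomputable def relArea (H : Λ → Subgroup G) (X : Set G) (R : Set (RelFree H X))
    (w : List (RelLetter H X)) : ℕ :=
  sInf {k | ∃ r c : Fin k → RelFree H X,
    (∀ i, r i ∈ R) ∧ wordToF w = (List.ofFn fun i => (c i)⁻¹ * r i * c i).prod}

/-- The relative Dehn function of the presentation `⟨X, H | R⟩`. -/
noncomputable def relDehn (H : Λ → Subgroup G) (X : Set G) (R : Set (RelFree H X))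
    (n : ℕ) : ℕ :=
  sSup {a | ∃ w : List (RelLetter H X), w.length ≤ n ∧ relEps H X (wordToF w) = 1 ∧
    a = relArea H X R w}

/-- The relative Dehn function is well-defined (finite for each value of the argument),
i.e. there exists a finite-valued relative isoperimetric function. -/
def DehnWellDefined (H : Λ → Subgroup G) (X : Set G) (R : Set (RelFree H X)) : Prop :=
  ∃ f : ℕ → ℕ, IsIsoperFn H X R f

/-- `f ⪯ g`. -/
def AsympLE (f g : ℕ → ℕ) : Prop := ∃ C K L : ℕ, ∀ n, f n ≤ C * g (K * n) + L * n

/-- `f ∼ g`. -/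
def AsympEquiv (f g : ℕ → ℕ) : Prop := AsympLE f g ∧ AsympLE g f

/-- `G` is hyperbolic relative to `H`: it admits a finite relative presentation with a
linear relative isoperimetric function. -/
def IsRelHyperbolic (H : Λ → Subgroup G) : Prop :=
  ∃ (X : Set G) (R : Set (RelFree H X)), IsFiniteRelPres H X R ∧
    ∃ A B : ℕ, IsIsoperFn H X R fun n => A * n + B

/-- The subnegative closure of `f`. -/
noncomputable def subnegClosure (f : ℕ → ℕ) (n : ℕ) : ℕ :=
  sSup {s | ∃ L : List ℕ, (∀ a ∈ L, 0 < a) ∧ L.sum = n ∧ s = (L.map f).sum}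

/-- A combinatorial path in the Cayley graph `Γ(G, X ∪ 𝓗)`: a starting vertex
together with the word labelling the path. -/
structure RelPath (H : Λ → Subgroup G) (X : Set G) where
  start : G
  word : List (RelLetter H X)

namespace RelPath

variable {H : Λ → Subgroup G} {X : Set G}

/-- The length of the path. -/
def len (p : RelPath H X) : ℕ := p.word.length

/-- The `k`-th vertex of the path. -/
def vertex (p : RelPath H X) (k : ℕ) : G :=
  p.start * ((p.word.take k).map RelLetter.val).prod

/-- The terminal vertex of the path. -/
def finish (p : RelPath H X) : G := p.vertex p.word.length

end RelPath

/-- The combinatorial metric `dist_{X ∪ 𝓗}` on `G`. -/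
noncomputable def relDist (H : Λ → Subgroup G) (X : Set G) (g h : G) : ℕ :=
  wordLength (X ∪ ⋃ l, (H l : Set G)) (g⁻¹ * h)

/-- The relative length `|g|_{X ∪ 𝓗}`. -/
noncomputable def relLen (H : Λ → Subgroup G) (X : Set G) (g : G) : ℕ :=
  wordLength (X ∪ ⋃ l, (H l : Set G)) g

/-- The word metric `dist_X` on `G`. -/
noncomputable def xDist (X : Set G) (g h : G) : ℕ := wordLength X (g⁻¹ * h)

variable {H : Λ → Subgroup G} {X : Set G}

/-- `p` is a `(λ, c)`-quasi-geodesic in `Γ(G, X ∪ 𝓗)`. -/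
def IsQuasiGeodesic (lam c : ℝ) (p : RelPath H X) : Prop :=
  ∀ i j : ℕ, i ≤ j → j ≤ p.len →
    ((j - i : ℕ) : ℝ) ≤ lam * (relDist H X (p.vertex i) (p.vertex j) : ℝ) + c

/-- `p` is a geodesic in `Γ(G, X ∪ 𝓗)`. -/
def IsGeodesic (p : RelPath H X) : Prop :=
  ∀ i j : ℕ, i ≤ j → j ≤ p.len → j - i = relDist H X (p.vertex i) (p.vertex j)

/-- The `k`-th letter of `p` is a letter of `H̃_l`. -/
def LetterIsH (p : RelPath H X) (l : Λ) (k : ℕ) : Prop :=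
  ∃ a, p.word[k]? = some a ∧ a.hIndex = some l

/-- The subpath of `p` consisting of the letters with indices `a, …, b` is an
`H_l`-component of `p` (a maximal nonempty `H_l`-subword). -/
def IsComponent (p : RelPath H X) (l : Λ) (a b : ℕ) : Prop :=
  a ≤ b ∧ b < p.len ∧ (∀ k, a ≤ k → k ≤ b → LetterIsH p l k) ∧
    (a = 0 ∨ ¬ LetterIsH p l (a - 1)) ∧ (b + 1 = p.len ∨ ¬ LetterIsH p l (b + 1))

/-- The `H_l`-components of `p` starting at index `a` and of `q` starting at `a'`
are connected (their vertices lie in the same left coset of `H_l`). -/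
def ConnectedComp (p q : RelPath H X) (l : Λ) (a a' : ℕ) : Prop :=
  (p.vertex a)⁻¹ * q.vertex a' ∈ H l

/-- `p` is a path without backtracking: all of its components are isolated. -/
def NoBacktracking (p : RelPath H X) : Prop :=
  ∀ l a b a' b', IsComponent p l a b → IsComponent p l a' b' →
    ConnectedComp p p l a a' → a = a' ∧ b = b'

/-- The `k`-th vertex of `p` is a phase vertex (not an inner vertex of a component). -/
def IsPhase (p : RelPath H X) (k : ℕ) : Prop :=
  ¬ ∃ l a b, IsComponent p l a b ∧ a < k ∧ k ≤ b

/-- `p` and `q` are `k`-similar: their endpoints are `X`-distance at most `k` apart. -/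
def Similar (k : ℝ) (p q : RelPath H X) : Prop :=
  (xDist X p.start q.start : ℝ) ≤ k ∧ (xDist X p.finish q.finish : ℝ) ≤ k

/-- The Rips thin-triangles condition for `Γ(G, X ∪ 𝓗)` with constant `δ`. -/
def RipsThin (H : Λ → Subgroup G) (X : Set G) (δ : ℝ) : Prop :=
  ∀ p q r : RelPath H X, IsGeodesic p → IsGeodesic q → IsGeodesic r →
    p.finish = q.start → q.finish = r.start → r.finish = p.start →
    ∀ i ≤ p.len, ∃ j : ℕ,
      (j ≤ q.len ∧ (relDist H X (p.vertex i) (q.vertex j) : ℝ) ≤ δ) ∨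
      (j ≤ r.len ∧ (relDist H X (p.vertex i) (r.vertex j) : ℝ) ≤ δ)

/-- The Cayley graph `Γ(G, X ∪ 𝓗)` is a hyperbolic metric space. -/
def CayleyHyperbolic (H : Λ → Subgroup G) (X : Set G) : Prop :=
  ∃ δ : ℝ, 0 ≤ δ ∧ RipsThin H X δ

/-- `R` is a relatively quasi-convex subgroup of `G`. -/
def RelQuasiconvex (H : Λ → Subgroup G) (X : Set G) (R : Subgroup G) : Prop :=
  ∃ σ : ℝ, 0 < σ ∧ ∀ p : RelPath H X, IsGeodesic p → p.start ∈ R → p.finish ∈ R →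
    ∀ k ≤ p.len, ∃ w ∈ R, (xDist X (p.vertex k) w : ℝ) ≤ σ

/-- `R` is a strongly relatively quasi-convex subgroup of `G`. -/
def StronglyRelQuasiconvex (H : Λ → Subgroup G) (X : Set G) (R : Subgroup G) : Prop :=
  RelQuasiconvex H X R ∧ ∀ (g : G) (l : Λ), {x : G | x ∈ R ∧ g * x * g⁻¹ ∈ H l}.Finite

/-- `g` is a hyperbolic element: it is not conjugate to an element of any `H_λ`. -/
def IsHypElt (H : Λ → Subgroup G) (g : G) : Prop :=
  ∀ l : Λ, ∀ x ∈ H l, ¬ IsConj g x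

end RelHyp

namespace RelHyp

section Metric

/-- An integer-valued metric (up to separation) in which any two points are joined by a geodesic. -/
structure IsGeodesicMetric {V : Type*} (d : V → V → ℕ) : Prop where
  self : ∀ x, d x x = 0
  symm : ∀ x y, d x y = d y x
  tri : ∀ x y z, d x z ≤ d x y + d y z
  geo : ∀ a b, ∃ γ : ℕ → V, γ 0 = a ∧ γ (d a b) = b ∧
    ∀ i j, i ≤ j → j ≤ d a b → d (γ i) (γ j) = j - i

/-- There is a path of `n` steps of size at most one from `a` to `b` inside `S`. -/
inductive StepPath {V : Type*} (d : V → V → ℕ) (S : Set V) : V → V → ℕ → Prop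
  | nil {a : V} : a ∈ S → StepPath d S a a 0
  | cons {a b c : V} {n : ℕ} : a ∈ S → d a b ≤ 1 → StepPath d S b c n → StepPath d S a c (n + 1)

/-- In a quadrilateral of step paths, the product of the distances between opposite sides is
linearly bounded by the perimeter. -/
def RectangleBound {V : Type*} (d : V → V → ℕ) (C : ℕ) : Prop :=
  ∀ (S₁ S₂ S₃ S₄ : Set V) (a b c e : V) (n₁ n₂ n₃ n₄ D₁ D₂ : ℕ),
    StepPath d S₁ a b n₁ → StepPath d S₂ b c n₂ → StepPath d S₃ e c n₃ → StepPath d S₄ a e n₄ →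
    (∀ x ∈ S₁, ∀ y ∈ S₃, D₁ + 1 ≤ d x y) → (∀ x ∈ S₂, ∀ y ∈ S₄, D₂ ≤ d x y) →
    D₁ * D₂ ≤ C * (n₁ + n₂ + n₃ + n₄ + 1)

/-- Gromov's four-point condition. -/
def FourPoint {V : Type*} (d : V → V → ℕ) (δ : ℕ) : Prop :=
  ∀ w x y z, d w y + d x z ≤ max (d w x + d y z) (d w z + d x y) + δ

variable {V : Type*} {d : V → V → ℕ}

lemma StepPath.left_mem {S : Set V} {a b : V} {n : ℕ} (h : StepPath d S a b n) : a ∈ S := by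
  cases h <;> assumption

lemma StepPath.mono {S S' : Set V} (hS : S ⊆ S') {a b : V} {n : ℕ} (h : StepPath d S a b n) :
    StepPath d S' a b n := by
  induction h with
  | nil ha => exact .nil (hS ha)
  | cons ha hab _ ih => exact .cons (hS ha) hab ih

lemma StepPath.trans {S : Set V} {a b c : V} {n m : ℕ} (h : StepPath d S a b n)
    (h' : StepPath d S b c m) : StepPath d S a c (n + m) := by
  induction h with
  | nil ha => simpa using h'
  | cons ha hab _ ih =>
    have := StepPath.cons ha hab (ih h')
    rwa [Nat.add_right_comm]

lemma StepPath.symm (hd : IsGeodesicMetric d) {S : Set V} {a b : V} {n : ℕ}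
    (h : StepPath d S a b n) : StepPath d S b a n := by
  induction h with
  | nil ha => exact .nil ha
  | cons ha hab hbc ih =>
    exact ih.trans (.cons hbc.left_mem (by rwa [hd.symm]) (.nil ha))

lemma stepPath_of_seq {S : Set V} (γ : ℕ → V) (i n : ℕ)
    (hS : ∀ k, i ≤ k → k ≤ i + n → γ k ∈ S)
    (hstep : ∀ k, i ≤ k → k < i + n → d (γ k) (γ (k + 1)) ≤ 1) :
    StepPath d S (γ i) (γ (i + n)) n := by
  induction n generalizing i with
  | zero => exact .nil (hS i le_rfl le_rfl)
  | succ n ih =>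
    refine .cons (hS i le_rfl (by omega)) (hstep i le_rfl (by omega)) ?_
    have := ih (i + 1) (fun k h1 h2 => hS k (by omega) (by omega))
      (fun k h1 h2 => hstep k (by omega) (by omega))
    rwa [show i + 1 + n = i + (n + 1) by omega] at this

/-- `γ` restricted to `[0, n]` is a geodesic. -/
def IsGeodSeq (d : V → V → ℕ) (γ : ℕ → V) (n : ℕ) : Prop :=
  ∀ i j, i ≤ j → j ≤ n → d (γ i) (γ j) = j - i

lemma IsGeodSeq.stepPath {γ : ℕ → V} {n : ℕ} (h : IsGeodSeq d γ n) {S : Set V} {i j : ℕ}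
    (hij : i ≤ j) (hj : j ≤ n) (hS : ∀ k, i ≤ k → k ≤ j → γ k ∈ S) :
    StepPath d S (γ i) (γ j) (j - i) := by
  have := stepPath_of_seq (d := d) (S := S) γ i (j - i) (fun k h1 h2 => hS k h1 (by omega))
    (fun k h1 h2 => by rw [h k (k + 1) (by omega) (by omega)]; omega)
  rwa [show i + (j - i) = j by omega] at this

lemma IsGeodSeq.stepPath_any (hd : IsGeodesicMetric d) {γ : ℕ → V} {n : ℕ}
    (h : IsGeodSeq d γ n) {S : Set V} (hS : ∀ k, k ≤ n → γ k ∈ S) {i j : ℕ}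
    (hi : i ≤ n) (hj : j ≤ n) :
    StepPath d S (γ i) (γ j) (d (γ i) (γ j)) := by
  rcases le_total i j with hij | hij
  · rw [h i j hij hj]
    exact h.stepPath hij hj fun k _ h2 => hS k (h2.trans hj)
  · rw [hd.symm, h j i hij hi]
    exact (h.stepPath hij hi fun k _ h2 => hS k (h2.trans hi)).symm hd

lemma exists_stepPath_ball (hd : IsGeodesicMetric d) (a b : V) :
    StepPath d {x | d x b ≤ d a b} a b (d a b) := by
  obtain ⟨γ, h0, h1, hγ⟩ := hd.geo a b
  have hγ' : IsGeodSeq d γ (d a b) := hγ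
  have := hγ'.stepPath (S := {x | d x b ≤ d a b}) (Nat.zero_le _) le_rfl (fun k _ hk => by
    have h := hγ k _ hk le_rfl
    rw [h1] at h
    simp only [Set.mem_ofPred_eq, h]; omega)
  rwa [h0, h1, Nat.sub_zero] at this

/-- The constant in the nearest-point projection estimate. -/
def projConst (C : ℕ) : ℕ :=
  let θ := 6 * C + 1
  2 * (θ * (6 * θ + 3) + 12 * C * θ + 3 * C + θ)

lemma le_of_rectangle_ineq {C θ Λ D : ℕ} (hθ : θ = 6 * C + 1)
    (h : D * θ ≤ C * (2 * Λ + 4 * θ + 1)) (hΛ : Λ ≤ 3 * D + 6 * θ + 3) :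
    Λ ≤ θ * (6 * θ + 3) + 12 * C * θ + 3 * C := by
  have h₁ : Λ * θ ≤ (3 * D + 6 * θ + 3) * θ := Nat.mul_le_mul_right _ hΛ
  have h₂ : Λ * θ = 6 * C * Λ + Λ := by rw [hθ]; ring
  linarith

lemma projection_estimate (hd : IsGeodesicMetric d) {C : ℕ} (hC : RectangleBound d C)
    {c : V} {β : ℕ → V} {n : ℕ} (hβ : IsGeodSeq d β n)
    (hnear : ∀ k ≤ n, d c (β 0) ≤ d c (β k)) :
    d c (β 0) + n ≤ d c (β n) + projConst C := by
  classical
  obtain ⟨μ, hμ0, hμ1, hμ⟩ := hd.geo (β 0) c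
  obtain ⟨ν, hν0, hν1, hν⟩ := hd.geo c (β n)
  set m := d (β 0) c with hm
  set l := d c (β n) with hl
  set θ := 6 * C + 1 with hθ
  have hθproj : projConst C = 2 * (θ * (6 * θ + 3) + 12 * C * θ + 3 * C + θ) := rfl
  have hcq : d c (β 0) = m := hd.symm _ _
  -- it suffices to find a point of `ν` close to `β 0`
  have key : ∀ t ≤ l, ∀ B, d (β 0) (ν t) ≤ B → m + n ≤ l + 2 * B := by
    intro t ht B hB
    have h1 := hd.tri c (ν t) (β 0)
    have h2 := hd.tri (β 0) (ν t) (β n)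
    have h3 := hν 0 t (Nat.zero_le _) ht
    have h4 := hν t l ht le_rfl
    have h5 := hβ 0 n (Nat.zero_le _) le_rfl
    rw [hν0] at h3
    rw [hν1] at h4
    rw [hd.symm (ν t) (β 0)] at h1
    omega
  have exi : ∃ i, i ≤ m ∧ ∃ t ≤ l, d (μ i) (ν t) ≤ θ :=
    ⟨m, le_rfl, 0, Nat.zero_le _, by rw [hμ1, hν0, hd.self]; omega⟩
  have exj : ∃ j, j ≤ n ∧ ∃ t ≤ l, d (β j) (ν t) ≤ θ :=
    ⟨n, le_rfl, l, le_rfl, by rw [hν1, hd.self]; omega⟩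
  set i := Nat.find exi with hi
  set j := Nat.find exj with hj
  obtain ⟨him, t₁, ht₁, hit⟩ := Nat.find_spec exi
  obtain ⟨hjn, t₂, ht₂, hjt⟩ := Nat.find_spec exj
  rw [← hi] at him hit
  rw [← hj] at hjn hjt
  have hmin_i : ∀ k < i, ∀ t ≤ l, θ < d (μ k) (ν t) := by
    intro k hk t ht
    by_contra hcon
    exact Nat.find_min exi hk ⟨by omega, t, ht, by omega⟩
  have hmin_j : ∀ k < j, ∀ t ≤ l, θ < d (β k) (ν t) := by
    intro k hk t ht
    by_contra hcon
    exact Nat.find_min exj hk ⟨by omega, t, ht, by omega⟩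
  rw [hcq, hθproj]
  rcases Nat.eq_zero_or_pos i with hi0 | hi0
  · rw [hi0, hμ0] at hit
    have := key t₁ ht₁ _ hit
    omega
  rcases Nat.eq_zero_or_pos j with hj0 | hj0
  · rw [hj0] at hjt
    have := key t₂ ht₂ _ hjt
    omega
  have hfar_i : ∀ k ≤ i, ∀ t ≤ l, θ ≤ d (μ k) (ν t) := by
    intro k hk t ht
    rcases hk.lt_or_eq with h | h
    · exact (hmin_i k h t ht).le
    · have h1 := hmin_i (i - 1) (by omega) t ht
      have h2 := hd.tri (μ (i - 1)) (μ i) (ν t)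
      have h3 := hμ (i - 1) i (by omega) him
      rw [h]; omega
  have hfar_j : ∀ k ≤ j, ∀ t ≤ l, θ ≤ d (β k) (ν t) := by
    intro k hk t ht
    rcases hk.lt_or_eq with h | h
    · exact (hmin_j k h t ht).le
    · have h1 := hmin_j (j - 1) (by omega) t ht
      have h2 := hd.tri (β (j - 1)) (β j) (ν t)
      have h3 := hβ (j - 1) j (by omega) hjn
      rw [h]; omega
  set r := d (μ i) (β j) with hr
  have hr1 : i ≤ r := by
    have h1 := hnear j hjn
    have h2 := hd.tri c (μ i) (β j)
    have h3 := hμ i m him le_rfl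
    rw [hμ1, hd.symm] at h3
    omega
  have hr2 : j ≤ i + r := by
    have h1 := hd.tri (β 0) (μ i) (β j)
    have h2 := hβ 0 j (Nat.zero_le _) hjn
    have h3 := hμ 0 i (Nat.zero_le _) him
    rw [hμ0] at h3
    omega
  have hΛ : i + j ≤ 3 * r := by omega
  have hbound : i + j ≤ θ * (6 * θ + 3) + 12 * C * θ + 3 * C := by
    rcases Nat.lt_or_ge r (2 * θ + 1) with hlt | hge
    · have : 1 ≤ θ := by omega
      nlinarith [Nat.zero_le (12 * C * θ + 3 * C), Nat.zero_le (θ * θ)]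
    obtain ⟨D, hD⟩ : ∃ D, r = D + (2 * θ + 1) := ⟨r - (2 * θ + 1), by omega⟩
    let S₂ : Set V := {x | ∃ k ≤ i, x = μ k} ∪ {x | ∃ k ≤ j, x = β k}
    let S₄ : Set V := {x | ∃ k ≤ l, x = ν k}
    have p₁ := exists_stepPath_ball hd (ν t₁) (μ i)
    have p₃ := exists_stepPath_ball hd (ν t₂) (β j)
    have p₂a : StepPath d S₂ (μ i) (β 0) (i - 0) := by
      rw [← hμ0]
      exact (IsGeodSeq.stepPath (S := S₂) (n := m) hμ (Nat.zero_le i) him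
        (fun k _ hk => Or.inl ⟨k, hk, rfl⟩)).symm hd
    have p₂b : StepPath d S₂ (β 0) (β j) (j - 0) :=
      hβ.stepPath (Nat.zero_le j) hjn (fun k _ hk => Or.inr ⟨k, hk, rfl⟩)
    have p₄ : StepPath d S₄ (ν t₁) (ν t₂) (d (ν t₁) (ν t₂)) :=
      IsGeodSeq.stepPath_any hd (S := S₄) (n := l) hν (fun k hk => ⟨k, hk, rfl⟩) ht₁ ht₂
    have h1 : d (ν t₁) (μ i) ≤ θ := by rw [hd.symm]; exact hit
    have h2 : d (ν t₂) (β j) ≤ θ := by rw [hd.symm]; exact hjt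
    have h3 : d (ν t₁) (ν t₂) ≤ i + j + 2 * θ := by
      have e1 := hd.tri (ν t₁) (μ i) (ν t₂)
      have e2 := hd.tri (μ i) (β 0) (ν t₂)
      have e3 := hd.tri (β 0) (β j) (ν t₂)
      have e4 := hβ 0 j (Nat.zero_le _) hjn
      have e5 := hμ 0 i (Nat.zero_le _) him
      rw [hμ0, hd.symm] at e5
      omega
    have := hC _ S₂ _ S₄ _ _ _ _ _ _ _ _ D θ p₁ (p₂a.trans p₂b) p₃ p₄ ?_ ?_
    · have h4 : d (ν t₁) (μ i) + (i - 0 + (j - 0)) + d (ν t₂) (β j) + d (ν t₁) (ν t₂) + 1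
          ≤ 2 * (i + j) + 4 * θ + 1 := by omega
      have h5 := this.trans (Nat.mul_le_mul_left C h4)
      exact le_of_rectangle_ineq hθ h5 (by omega)
    · intro x hx y hy
      simp only [Set.mem_ofPred_eq] at hx hy
      have e1 := hd.tri (μ i) x (β j)
      have e2 := hd.tri x y (β j)
      rw [hd.symm (μ i) x] at e1
      omega
    · rintro x (⟨k, hk, rfl⟩ | ⟨k, hk, rfl⟩) y ⟨t, ht, rfl⟩
      · exact hfar_i k hk t ht
      · exact hfar_j k hk t ht
  have hqt : d (β 0) (ν t₁) ≤ θ * (6 * θ + 3) + 12 * C * θ + 3 * C + θ := by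
    have e1 := hd.tri (β 0) (μ i) (ν t₁)
    have e5 := hμ 0 i (Nat.zero_le _) him
    rw [hμ0] at e5
    omega
  exact key t₁ ht₁ _ hqt

lemma projection_estimate_sub (hd : IsGeodesicMetric d) {C : ℕ} (hC : RectangleBound d C)
    {c : V} {γ : ℕ → V} {n k : ℕ} (hγ : IsGeodSeq d γ n) (hk : k ≤ n)
    (hnear : ∀ j ≤ n, d c (γ k) ≤ d c (γ j)) :
    d c (γ k) + (n - k) ≤ d c (γ n) + projConst C ∧ d c (γ k) + k ≤ d c (γ 0) + projConst C := by
  constructor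
  · have := projection_estimate hd hC (c := c) (β := fun i => γ (k + i)) (n := n - k)
      (fun i j hij hj => by
        have := hγ (k + i) (k + j) (by omega) (by omega)
        simp only [this]; omega)
      (fun j hj => hnear _ (by omega))
    simpa [Nat.add_sub_cancel' hk] using this
  · have := projection_estimate hd hC (c := c) (β := fun i => γ (k - i)) (n := k)
      (fun i j hij hj => by
        have := hγ (k - j) (k - i) (by omega) (by omega)
        simp only [hd.symm (γ (k - i)), this]; omega)
      (fun j hj => hnear _ (by omega))
    simpa using this

lemma exists_nearest (c : V) (γ : ℕ → V) (n : ℕ) :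
    ∃ k ≤ n, ∀ j ≤ n, d c (γ k) ≤ d c (γ j) := by
  obtain ⟨k, hk, hmin⟩ := Finset.exists_min_image (Finset.range (n + 1)) (fun j => d c (γ j))
    ⟨0, by simp⟩
  exact ⟨k, by simpa [Nat.lt_succ_iff] using hk,
    fun j hj => hmin j (by simpa [Nat.lt_succ_iff] using hj)⟩

theorem fourPoint_of_rectangleBound (hd : IsGeodesicMetric d) {C : ℕ} (hC : RectangleBound d C) :
    FourPoint d (3 * projConst C) := by
  intro w x y z
  obtain ⟨γ, h0, h1, hγ⟩ := hd.geo x z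
  obtain ⟨k, hk, hkn⟩ := exists_nearest (d := d) w γ (d x z)
  obtain ⟨l, hl, hln⟩ := exists_nearest (d := d) y γ (d x z)
  obtain ⟨a1, a2⟩ := projection_estimate_sub hd hC hγ hk hkn
  obtain ⟨b1, b2⟩ := projection_estimate_sub hd hC hγ hl hln
  rw [h0] at a2 b2
  rw [h1] at a1 b1
  have t1 := hd.tri w (γ k) y
  have t2 := hd.tri (γ k) (γ l) y
  rw [hd.symm (γ l) y] at t2
  rw [hd.symm x y]
  rcases le_total k l with h | h
  · have := hγ k l h hl
    omega
  · have := hγ l k h hk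
    rw [hd.symm] at this
    omega

end Metric

section Words

variable {G : Type*} [Group G] {Λ : Type*} {H : Λ → Subgroup G} {X : Set G}

/-- The element of `G` represented by a word. -/
def wordVal (w : List (RelLetter H X)) : G := (w.map RelLetter.val).prod

@[simp] lemma wordVal_nil : wordVal ([] : List (RelLetter H X)) = 1 := rfl

@[simp] lemma wordVal_cons (a : RelLetter H X) (w : List (RelLetter H X)) :
    wordVal (a :: w) = a.val * wordVal w := by simp [wordVal]

@[simp] lemma wordVal_append (w w' : List (RelLetter H X)) :
    wordVal (w ++ w') = wordVal w * wordVal w' := by simp [wordVal]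

lemma wordToF_cons (a : RelLetter H X) (w : List (RelLetter H X)) :
    wordToF (a :: w) = a.toF * wordToF w := by simp [wordToF]

lemma wordToF_append (w w' : List (RelLetter H X)) :
    wordToF (w ++ w') = wordToF w * wordToF w' := by simp [wordToF]

lemma relEps_toF (a : RelLetter H X) : relEps H X a.toF = a.val := by
  rcases a with ⟨l, h⟩ | ⟨x, _ | _⟩ <;> simp [RelLetter.toF, RelLetter.val, relEps]

lemma relEps_wordToF (w : List (RelLetter H X)) : relEps H X (wordToF w) = wordVal w := by
  induction w with
  | nil => simp [wordToF]
  | cons a w ih => rw [wordToF_cons, map_mul, ih, relEps_toF, wordVal_cons]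

/-- The formal inverse of a letter. -/
def RelLetter.inv : RelLetter H X → RelLetter H X
  | Sum.inl ⟨l, h⟩ => Sum.inl ⟨l, ⟨h.1⁻¹, inv_ne_one.2 h.2⟩⟩
  | Sum.inr (x, b) => Sum.inr (x, !b)

lemma RelLetter.toF_inv (a : RelLetter H X) : a.inv.toF = a.toF⁻¹ := by
  rcases a with ⟨l, h⟩ | ⟨x, _ | _⟩ <;> simp [RelLetter.toF, RelLetter.inv]

/-- The formal inverse of a word. -/
def wordInv (w : List (RelLetter H X)) : List (RelLetter H X) := (w.map RelLetter.inv).reverse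

lemma length_wordInv (w : List (RelLetter H X)) : (wordInv w).length = w.length := by
  simp [wordInv]

lemma wordToF_inv (w : List (RelLetter H X)) : wordToF (wordInv w) = (wordToF w)⁻¹ := by
  induction w with
  | nil => simp [wordToF, wordInv]
  | cons a w ih =>
    have : wordInv (a :: w) = wordInv w ++ [a.inv] := by simp [wordInv]
    rw [this, wordToF_append, ih, wordToF_cons a w, mul_inv_rev, ← RelLetter.toF_inv]
    simp [wordToF]

lemma wordVal_inv (w : List (RelLetter H X)) : wordVal (wordInv w) = (wordVal w)⁻¹ := by
  rw [← relEps_wordToF, wordToF_inv, map_inv, relEps_wordToF]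

lemma exists_wordToF_eq (f : RelFree H X) : ∃ w : List (RelLetter H X), wordToF w = f := by
  induction f using Monoid.Coprod.induction_on with
  | inl f =>
    induction f using Monoid.CoprodI.induction_on with
    | one => exact ⟨[], by simp [wordToF]⟩
    | of l h =>
      by_cases hh : h = 1
      · exact ⟨[], by simp [wordToF, hh]⟩
      · exact ⟨[Sum.inl ⟨l, ⟨h, hh⟩⟩], by simp [wordToF, RelLetter.toF]⟩
    | mul x y hx hy =>
      obtain ⟨w, hw⟩ := hx
      obtain ⟨w', hw'⟩ := hy
      exact ⟨w ++ w', by rw [wordToF_append, hw, hw', map_mul]⟩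
  | inr f =>
    induction f using FreeGroup.induction_on with
    | C1 => exact ⟨[], by simp [wordToF]⟩
    | of x => exact ⟨[Sum.inr (x, true)], by simp [wordToF, RelLetter.toF]⟩
    | inv_of x _ => exact ⟨[Sum.inr (x, false)], by simp [wordToF, RelLetter.toF]⟩
    | mul x y hx hy =>
      obtain ⟨w, hw⟩ := hx
      obtain ⟨w', hw'⟩ := hy
      exact ⟨w ++ w', by rw [wordToF_append, hw, hw', map_mul]⟩
  | mul x y hx hy =>
    obtain ⟨w, hw⟩ := hx
    obtain ⟨w', hw'⟩ := hy
    exact ⟨w ++ w', by rw [wordToF_append, hw, hw']⟩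

end Words

section Cocycles

variable {G : Type*} [Group G] {Λ : Type*} {H : Λ → Subgroup G} {X : Set G}

/-- The semidirect product of the integer-valued functions on `G` by `G` acting through right
translations. -/
@[ext] structure TransFun (G : Type*) where
  /-- the function -/
  fn : G → ℤ
  /-- the translation -/
  el : G

instance : Group (TransFun G) where
  mul a b := ⟨fun y => a.fn y + b.fn (y * a.el), a.el * b.el⟩
  one := ⟨fun _ => 0, 1⟩
  inv a := ⟨fun y => -a.fn (y * a.el⁻¹), a.el⁻¹⟩
  mul_assoc a b c := by
    refine TransFun.ext (funext fun y => ?_) (mul_assoc _ _ _)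
    change (a.fn y + b.fn (y * a.el)) + c.fn (y * (a.el * b.el)) =
      a.fn y + (b.fn (y * a.el) + c.fn (y * a.el * b.el))
    rw [mul_assoc, add_assoc]
  one_mul a := by
    refine TransFun.ext (funext fun y => ?_) (one_mul _)
    change 0 + a.fn (y * 1) = a.fn y
    simp
  mul_one a := by
    refine TransFun.ext (funext fun y => ?_) (mul_one _)
    change a.fn y + 0 = a.fn y
    simp
  inv_mul_cancel a := by
    refine TransFun.ext (funext fun y => ?_) (inv_mul_cancel a.el)
    change -a.fn (y * a.el⁻¹) + a.fn (y * a.el⁻¹) = 0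
    simp

namespace TransFun

@[simp] lemma mul_fn (a b : TransFun G) (y : G) : (a * b).fn y = a.fn y + b.fn (y * a.el) := rfl
@[simp] lemma mul_el (a b : TransFun G) : (a * b).el = a.el * b.el := rfl
@[simp] lemma one_fn (y : G) : (1 : TransFun G).fn y = 0 := rfl
@[simp] lemma one_el : (1 : TransFun G).el = 1 := rfl
@[simp] lemma inv_fn (a : TransFun G) (y : G) : (a⁻¹).fn y = -a.fn (y * a.el⁻¹) := rfl
@[simp] lemma inv_el (a : TransFun G) : (a⁻¹).el = a.el⁻¹ := rfl

lemma abs_fn_prod_le {M : ℕ} (L : List (TransFun G)) (hel : ∀ a ∈ L, a.el = 1)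
    (hM : ∀ a ∈ L, ∀ y, |a.fn y| ≤ M) (y : G) : |L.prod.fn y| ≤ M * L.length := by
  induction L generalizing y with
  | nil => simp
  | cons a L ih =>
    have h1 := ih (fun b hb => hel b (List.mem_cons_of_mem _ hb))
      (fun b hb => hM b (List.mem_cons_of_mem _ hb)) (y * a.el)
    have h2 := hM a List.mem_cons_self y
    rw [List.prod_cons, mul_fn, List.length_cons]
    push_cast
    calc _ ≤ |a.fn y| + |L.prod.fn (y * a.el)| := abs_add_le _ _
      _ ≤ _ := by linarith

end TransFun

/-- A family of functions on the edges of the relative Cayley graph that is additive on the edges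
labelled by each of the subgroups. -/
structure EdgeForm (H : Λ → Subgroup G) (X : Set G) where
  /-- the value on the edge from `y` to `y * h` -/
  onH : ∀ l, G → H l → ℤ
  /-- the value on the edge from `y` to `y * x` -/
  onX : G → X → ℤ
  add : ∀ l y h h', onH l y (h * h') = onH l y h + onH l (y * h) h'

namespace EdgeForm

variable (θ : EdgeForm H X)

lemma onH_one (l : Λ) (y : G) : θ.onH l y 1 = 0 := by
  have := θ.add l y 1 1
  simpa using this

/-- The value of the form on the edge starting at `y` with a given label. -/
def onLetter (y : G) : RelLetter H X → ℤ
  | Sum.inl ⟨l, h⟩ => θ.onH l y h.1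
  | Sum.inr (x, true) => θ.onX y x
  | Sum.inr (x, false) => -θ.onX (y * (x : G)⁻¹) x

/-- The integral of the form along the path starting at `y` with a given label. -/
def integral : G → List (RelLetter H X) → ℤ
  | _, [] => 0
  | y, a :: w => θ.onLetter y a + integral (y * a.val) w

@[simp] lemma integral_nil (y : G) : θ.integral y [] = 0 := rfl

@[simp] lemma integral_cons (y : G) (a : RelLetter H X) (w : List (RelLetter H X)) :
    θ.integral y (a :: w) = θ.onLetter y a + θ.integral (y * a.val) w := rfl

lemma integral_append (y : G) (w w' : List (RelLetter H X)) :
    θ.integral y (w ++ w') = θ.integral y w + θ.integral (y * wordVal w) w' := by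
  induction w generalizing y with
  | nil => simp
  | cons a w ih => simp [ih, mul_assoc, add_assoc]

/-- Integration as a homomorphism on the free product. -/
def toHom : RelFree H X →* TransFun G :=
  Monoid.Coprod.lift
    (Monoid.CoprodI.lift fun l =>
      { toFun := fun h => ⟨fun y => θ.onH l y h, h⟩
        map_one' := TransFun.ext (funext fun y => θ.onH_one l y) rfl
        map_mul' := fun h h' => TransFun.ext (funext fun y => θ.add l y h h') rfl })
    (FreeGroup.lift fun x => ⟨fun y => θ.onX y x, x⟩)

lemma toHom_toF (a : RelLetter H X) : θ.toHom a.toF = ⟨fun y => θ.onLetter y a, a.val⟩ := by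
  rcases a with ⟨l, h⟩ | ⟨x, _ | _⟩
  · simp [RelLetter.toF, RelLetter.val, toHom, onLetter]
  · simp only [RelLetter.toF, RelLetter.val, toHom, onLetter]
    simp
    rfl
  · simp [RelLetter.toF, RelLetter.val, toHom, onLetter]

lemma toHom_wordToF_el (w : List (RelLetter H X)) : (θ.toHom (wordToF w)).el = wordVal w := by
  induction w with
  | nil => simp [wordToF]
  | cons a w ih => simp [wordToF_cons, ih, toHom_toF]

lemma toHom_wordToF_fn (w : List (RelLetter H X)) (y : G) :
    (θ.toHom (wordToF w)).fn y = θ.integral y w := by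
  induction w generalizing y with
  | nil => simp [wordToF]
  | cons a w ih => simp [wordToF_cons, ih, toHom_toF]

end EdgeForm

/-- A dual form of the linear isoperimetric inequality: the integral of an edge form around a loop
is linearly bounded in terms of its integrals around finitely many loops. -/
theorem exists_stokes {R : Set (RelFree H X)} (hpres : IsFiniteRelPres H X R) {A B : ℕ}
    (hiso : IsIsoperFn H X R fun n => A * n + B) :
    ∃ W : Set (List (RelLetter H X)), W.Finite ∧ (∀ w ∈ W, wordVal w = 1) ∧
      ∀ (θ : EdgeForm H X) (M : ℕ), (∀ w ∈ W, ∀ y, |θ.integral y w| ≤ M) →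
        ∀ (y : G) (w w' : List (RelLetter H X)), wordVal w = wordVal w' →
          |θ.integral y w - θ.integral y w'| ≤ M * (A * (w.length + w'.length) + B) := by
  choose W hW using exists_wordToF_eq (H := H) (X := X)
  have hker : ∀ r ∈ R, wordVal (W r) = 1 := by
    intro r hr
    rw [← relEps_wordToF, hW, ← MonoidHom.mem_ker, hpres.ker]
    exact Subgroup.subset_normalClosure hr
  refine ⟨W '' R, hpres.finR.image W, ?_, ?_⟩
  · rintro _ ⟨r, hr, rfl⟩
    exact hker r hr
  intro θ M hM y w w' hww
  have hval : wordVal (w ++ wordInv w') = 1 := by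
    rw [wordVal_append, wordVal_inv, hww, mul_inv_cancel]
  obtain ⟨k, hk, r, c, hr, hprod⟩ := hiso (w ++ wordInv w') (by rw [relEps_wordToF, hval])
  have hint : θ.integral y w - θ.integral y w' = (θ.toHom (wordToF (w ++ wordInv w'))).fn y := by
    rw [wordToF_append, wordToF_inv, map_mul, map_inv, TransFun.mul_fn, TransFun.inv_fn,
      EdgeForm.toHom_wordToF_fn, EdgeForm.toHom_wordToF_fn, EdgeForm.toHom_wordToF_el,
      EdgeForm.toHom_wordToF_el, hww]
    simp [sub_eq_add_neg]
  have hrel : ∀ i, (θ.toHom (r i)).el = 1 := by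
    intro i
    rw [← hW (r i), EdgeForm.toHom_wordToF_el, hker _ (hr i)]
  have hrM : ∀ i y, |(θ.toHom (r i)).fn y| ≤ M := by
    intro i y
    rw [← hW (r i), EdgeForm.toHom_wordToF_fn]
    exact hM _ ⟨_, hr i, rfl⟩ y
  have hle := TransFun.abs_fn_prod_le (M := M)
    (List.ofFn fun i => θ.toHom ((c i)⁻¹ * r i * c i)) ?_ ?_ y
  · rw [hint, hprod, map_list_prod, List.map_ofFn]
    refine hle.trans ?_
    rw [List.length_ofFn]
    have : k ≤ A * (w.length + w'.length) + B := by
      simpa [length_wordInv] using hk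
    gcongr
    exact_mod_cast this
  · intro a ha
    obtain ⟨i, rfl⟩ := (List.mem_ofFn' _ _).1 ha
    simp [hrel]
  · intro a ha y
    obtain ⟨i, rfl⟩ := (List.mem_ofFn' _ _).1 ha
    simpa [hrel] using hrM i _

end Cocycles

section Metric
variable {V : Type*} {d : V → V → ℕ}

lemma StepPath.right_mem {S : Set V} {a b : V} {n : ℕ} (h : StepPath d S a b n) : b ∈ S := by
  induction h <;> assumption

/-- The distance to a set, truncated at `D`. -/
noncomputable def truncDist (d : V → V → ℕ) (S : Set V) (D : ℕ) (x : V) : ℕ :=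
  min D (sInf {n | ∃ s ∈ S, d s x = n})

lemma truncDist_eq_zero (hd : IsGeodesicMetric d) {S : Set V} (D : ℕ) {x : V} (hx : x ∈ S) :
    truncDist d S D x = 0 := by
  have : sInf {n | ∃ s ∈ S, d s x = n} ≤ 0 := Nat.sInf_le ⟨x, hx, hd.self x⟩
  simp only [truncDist]; omega

lemma truncDist_eq {S : Set V} (hS : S.Nonempty) {D : ℕ} {x : V} (hx : ∀ s ∈ S, D ≤ d s x) :
    truncDist d S D x = D := by
  obtain ⟨s, hs⟩ := hS
  obtain ⟨t, ht, hte⟩ := Nat.sInf_mem (s := {n | ∃ s ∈ S, d s x = n}) ⟨_, s, hs, rfl⟩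
  have := hx t ht
  simp only [truncDist]; omega

lemma truncDist_le_add (hd : IsGeodesicMetric d) {S : Set V} (hS : S.Nonempty) (D : ℕ) (x y : V) :
    truncDist d S D x ≤ truncDist d S D y + d x y := by
  obtain ⟨s, hs⟩ := hS
  obtain ⟨t, ht, hte⟩ := Nat.sInf_mem (s := {n | ∃ s ∈ S, d s y = n}) ⟨_, s, hs, rfl⟩
  have h1 : sInf {n | ∃ s ∈ S, d s x = n} ≤ d t x := Nat.sInf_le ⟨t, ht, rfl⟩
  have h2 := hd.tri t y x
  rw [hd.symm y x] at h2
  simp only [truncDist]; omega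

end Metric

section LetterMetric

variable {G : Type*} [Group G] {Λ : Type*} (H : Λ → Subgroup G) (X : Set G)

/-- The least number of letters in a word over `X ∪ 𝓗` representing `g`. -/
noncomputable def letterLength (g : G) : ℕ :=
  sInf {n | ∃ w : List (RelLetter H X), w.length = n ∧ wordVal w = g}

/-- The left-invariant metric associated with `letterLength`. -/
noncomputable def letterDist (x y : G) : ℕ := letterLength H X (x⁻¹ * y)

/-- Every element of the group is represented by a word. -/
def Generates : Prop := ∀ g : G, ∃ w : List (RelLetter H X), wordVal w = g

variable {H X}

lemma exists_word_length_eq (hgen : Generates H X) (g : G) :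
    ∃ w : List (RelLetter H X), w.length = letterLength H X g ∧ wordVal w = g := by
  obtain ⟨w, hw⟩ := hgen g
  exact Nat.sInf_mem (s := {n | ∃ w : List (RelLetter H X), w.length = n ∧ wordVal w = g})
    ⟨_, w, rfl, hw⟩

lemma letterLength_wordVal_le (w : List (RelLetter H X)) :
    letterLength H X (wordVal w) ≤ w.length := Nat.sInf_le ⟨w, rfl, rfl⟩

lemma letterLength_one : letterLength H X (1 : G) = 0 := by
  simpa using letterLength_wordVal_le ([] : List (RelLetter H X))

lemma letterLength_mul_le (hgen : Generates H X) (g h : G) :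
    letterLength H X (g * h) ≤ letterLength H X g + letterLength H X h := by
  obtain ⟨w, hw, rfl⟩ := exists_word_length_eq hgen g
  obtain ⟨w', hw', rfl⟩ := exists_word_length_eq hgen h
  rw [← hw, ← hw', ← wordVal_append, ← List.length_append]
  exact letterLength_wordVal_le _

lemma letterLength_inv_le (hgen : Generates H X) (g : G) :
    letterLength H X g⁻¹ ≤ letterLength H X g := by
  obtain ⟨w, hw, rfl⟩ := exists_word_length_eq hgen g
  rw [← hw, ← length_wordInv, ← wordVal_inv]
  exact letterLength_wordVal_le _

lemma letterLength_inv (hgen : Generates H X) (g : G) :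
    letterLength H X g⁻¹ = letterLength H X g :=
  (letterLength_inv_le hgen g).antisymm (by simpa using letterLength_inv_le hgen g⁻¹)

lemma letterLength_val_le (a : RelLetter H X) : letterLength H X a.val ≤ 1 := by
  simpa using letterLength_wordVal_le [a]

lemma letterLength_le_one_of_mem {l : Λ} {h : G} (hh : h ∈ H l) : letterLength H X h ≤ 1 := by
  by_cases h1 : h = 1
  · rw [h1, letterLength_one]; omega
  · exact letterLength_val_le
      (Sum.inl ⟨l, ⟨⟨h, hh⟩, fun e => h1 (congrArg Subtype.val e)⟩⟩ : RelLetter H X)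

lemma letterDist_mul_left (g x y : G) : letterDist H X (g * x) (g * y) = letterDist H X x y := by
  simp [letterDist, mul_assoc]

lemma letterDist_mul_right (x g : G) : letterDist H X x (x * g) = letterLength H X g := by
  simp [letterDist]

/-- A word of minimal length among the words representing the same element. -/
def IsGeodesicWord (w : List (RelLetter H X)) : Prop :=
  letterLength H X (wordVal w) = w.length

lemma IsGeodesicWord.append_left (hgen : Generates H X) {u v : List (RelLetter H X)}
    (h : IsGeodesicWord (u ++ v)) : IsGeodesicWord u := by
  have h1 := letterLength_mul_le hgen (wordVal u) (wordVal v)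
  have h2 := letterLength_wordVal_le u
  have h3 := letterLength_wordVal_le v
  rw [IsGeodesicWord, wordVal_append, List.length_append] at h
  rw [IsGeodesicWord]; omega

lemma IsGeodesicWord.append_right (hgen : Generates H X) {u v : List (RelLetter H X)}
    (h : IsGeodesicWord (u ++ v)) : IsGeodesicWord v := by
  have h1 := letterLength_mul_le hgen (wordVal u) (wordVal v)
  have h2 := letterLength_wordVal_le u
  have h3 := letterLength_wordVal_le v
  rw [IsGeodesicWord, wordVal_append, List.length_append] at h
  rw [IsGeodesicWord]; omega

lemma exists_geodesicWord (hgen : Generates H X) (g : G) :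
    ∃ w : List (RelLetter H X), IsGeodesicWord w ∧ wordVal w = g := by
  obtain ⟨w, hw, rfl⟩ := exists_word_length_eq hgen g
  exact ⟨w, hw.symm, rfl⟩

lemma isGeodesicMetric_letterDist (hgen : Generates H X) : IsGeodesicMetric (letterDist H X) where
  self x := by simp [letterDist, letterLength_one]
  symm x y := by
    rw [letterDist, letterDist, ← letterLength_inv hgen]
    simp
  tri x y z := by
    have := letterLength_mul_le hgen (x⁻¹ * y) (y⁻¹ * z)
    simpa [letterDist, mul_assoc] using this
  geo a b := by
    obtain ⟨w, hw, hv⟩ := exists_geodesicWord hgen (a⁻¹ * b)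
    have hlen : w.length = letterDist H X a b := by rw [letterDist, ← hv, ← hw]
    refine ⟨fun i => a * wordVal (w.take i), by simp, ?_, ?_⟩
    · rw [← hlen]; simp [hv]
    · intro i j hij hj
      rw [letterDist_mul_left]
      have h1 : w.take j = w.take i ++ (w.take j).drop i := by
        conv_lhs => rw [← List.take_append_drop i (w.take j), List.take_take, min_eq_left hij]
      have h2 : IsGeodesicWord (w.take j) := by
        rw [← List.take_append_drop j w] at hw
        exact hw.append_left hgen
      rw [h1] at h2 ⊢
      have h3 := h2.append_right hgen
      rw [wordVal_append, letterDist_mul_right, h3]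
      simp only [List.length_drop, List.length_take]
      omega

/-- The path starting at `y` and labelled by `w` stays in `S`. -/
def StaysIn (S : Set G) : G → List (RelLetter H X) → Prop
  | y, [] => y ∈ S
  | y, a :: w => y ∈ S ∧ StaysIn S (y * a.val) w

lemma StaysIn.left_mem {S : Set G} {y : G} {w : List (RelLetter H X)} (h : StaysIn S y w) :
    y ∈ S := by
  cases w with
  | nil => exact h
  | cons a w => exact h.1

lemma StepPath.exists_word (hgen : Generates H X) {S : Set G} {a b : G} {n : ℕ}
    (h : StepPath (letterDist H X) S a b n) :
    ∃ w : List (RelLetter H X), w.length ≤ n ∧ a * wordVal w = b ∧ StaysIn S a w := by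
  induction h with
  | nil ha => exact ⟨[], le_rfl, by simp, ha⟩
  | @cons a b c n ha hab hbc ih =>
    obtain ⟨w, hw, hwv, hwS⟩ := ih
    obtain ⟨u, hu, huv⟩ := exists_word_length_eq hgen (a⁻¹ * b)
    have hu1 : u.length ≤ 1 := by rw [hu]; exact hab
    match u, hu1, huv with
    | [], _, huv =>
      have : a = b := by simpa [eq_inv_mul_iff_mul_eq] using huv
      exact ⟨w, by omega, by rw [this]; exact hwv, by rw [this]; exact hwS⟩
    | [x], _, huv =>
      have hx : a * x.val = b := by simpa [eq_inv_mul_iff_mul_eq] using huv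
      refine ⟨x :: w, by simpa using hw, ?_, ha, ?_⟩
      · rw [wordVal_cons, ← mul_assoc, hx, hwv]
      · rw [hx]; exact hwS

end LetterMetric

section Rectangle

variable {G : Type*} [Group G] {Λ : Type*} {H : Λ → Subgroup G} {X : Set G}

/-- The minimum of `f` over the left coset of `H l` containing `y`. -/
noncomputable def cosetMin (H : Λ → Subgroup G) (f : G → ℕ) (l : Λ) (y : G) : ℕ :=
  sInf {n | ∃ h ∈ H l, f (y * h) = n}

lemma exists_cosetMin_eq (f : G → ℕ) (l : Λ) (y : G) : ∃ h ∈ H l, cosetMin H f l y = f (y * h) := by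
  obtain ⟨h, hh, he⟩ := Nat.sInf_mem (s := {n | ∃ h ∈ H l, f (y * h) = n})
    ⟨_, 1, (H l).one_mem, rfl⟩
  exact ⟨h, hh, he.symm⟩

lemma cosetMin_le (f : G → ℕ) (l : Λ) (y : G) : cosetMin H f l y ≤ f y :=
  Nat.sInf_le ⟨1, (H l).one_mem, by simp⟩

lemma cosetMin_mul (f : G → ℕ) (l : Λ) (y : G) {h : G} (hh : h ∈ H l) :
    cosetMin H f l (y * h) = cosetMin H f l y := by
  unfold cosetMin
  congr 1
  ext n
  constructor
  · rintro ⟨k, hk, rfl⟩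
    exact ⟨h * k, (H l).mul_mem hh hk, by rw [mul_assoc]⟩
  · rintro ⟨k, hk, rfl⟩
    exact ⟨h⁻¹ * k, (H l).mul_mem ((H l).inv_mem hh) hk, by simp [mul_assoc]⟩

/-- The discrete one-form `f dg`, where on the edges labelled by `H l` the coefficient `f` is
replaced by its minimum over the coset. -/
noncomputable def wedgeForm (H : Λ → Subgroup G) (X : Set G) (f g : G → ℕ) : EdgeForm H X where
  onH l y h := cosetMin H f l y * ((g (y * h) : ℤ) - g y)
  onX y x := f y * ((g (y * x) : ℤ) - g y)
  add l y h h' := by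
    rw [cosetMin_mul f l y h.2, Subgroup.coe_mul, mul_assoc]
    ring

lemma exists_wedgeForm_onLetter_eq (f g : G → ℕ) (y : G) (a : RelLetter H X) :
    ∃ z, letterDist H X y z ≤ 1 ∧
      (wedgeForm H X f g).onLetter y a = f z * ((g (y * a.val) : ℤ) - g y) ∧
      (f y = 0 → f (y * a.val) = 0 → f z = 0) := by
  rcases a with ⟨l, h⟩ | ⟨x, _ | _⟩
  · obtain ⟨k, hk, he⟩ := exists_cosetMin_eq (H := H) f l y
    refine ⟨y * k, ?_, ?_, ?_⟩
    · rw [letterDist_mul_right]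
      exact letterLength_le_one_of_mem hk
    · simp [EdgeForm.onLetter, wedgeForm, he, RelLetter.val]
    · intro h0 _
      have := cosetMin_le (H := H) f l y
      omega
  · refine ⟨y * (x : G)⁻¹, ?_, ?_, ?_⟩
    · rw [letterDist_mul_right]
      exact letterLength_val_le (Sum.inr (x, false) : RelLetter H X)
    · simp only [EdgeForm.onLetter, wedgeForm, RelLetter.val]
      simp only [inv_mul_cancel_right, Bool.false_eq_true, if_false]
      ring
    · intro _ h0
      simpa [RelLetter.val] using h0
  · refine ⟨y, ?_, ?_, fun h0 _ => h0⟩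
    · simp [letterDist, letterLength_one]
    · simp [EdgeForm.onLetter, wedgeForm, RelLetter.val]

lemma abs_integral_wedgeForm_sub_le {f g : G → ℕ}
    (hf : ∀ x y, f x ≤ f y + letterDist H X x y) (hg : ∀ x y, g x ≤ g y + letterDist H X x y)
    (hgen : Generates H X) (y : G) (w : List (RelLetter H X)) :
    |(wedgeForm H X f g).integral y w - f y * ((g (y * wordVal w) : ℤ) - g y)| ≤
      (w.length : ℤ) ^ 2 := by
  have hd := isGeodesicMetric_letterDist hgen
  induction w generalizing y with
  | nil => simp
  | cons a w ih =>
    obtain ⟨z, hz, he, -⟩ := exists_wedgeForm_onLetter_eq f g y a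
    have hlip : ∀ {f : G → ℕ}, (∀ x y, f x ≤ f y + letterDist H X x y) → ∀ u v n,
        letterDist H X u v ≤ n → |(f u : ℤ) - f v| ≤ n := by
      intro f hf u v n hn
      have h1 := hf u v
      have h2 := hf v u
      rw [hd.symm v u] at h2
      rw [abs_le]; constructor <;> omega
    have hya : letterDist H X y (y * a.val) ≤ 1 := by
      rw [letterDist_mul_right]; exact letterLength_val_le a
    have h1 := hlip hf z y 1 (by rwa [hd.symm])
    have h2 := hlip hf (y * a.val) y 1 (by rwa [hd.symm])
    have h3 := hlip hg (y * a.val) y 1 (by rwa [hd.symm])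
    have h4 := hlip hg (y * a.val * wordVal w) (y * a.val) w.length (by
      rw [hd.symm, letterDist_mul_right]; exact letterLength_wordVal_le w)
    have h5 := ih (y * a.val)
    rw [EdgeForm.integral_cons, he, wordVal_cons, ← mul_assoc, List.length_cons]
    set I := (wedgeForm H X f g).integral (y * a.val) w
    set p : ℤ := (f z : ℤ) - f y
    set q : ℤ := (f (y * a.val) : ℤ) - f y
    set s : ℤ := (g (y * a.val) : ℤ) - g y
    set t : ℤ := (g (y * a.val * wordVal w) : ℤ) - g (y * a.val)
    have hdecomp : (f z : ℤ) * s + I - f y * ((g (y * a.val * wordVal w) : ℤ) - g y) =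
        p * s + (I - f (y * a.val) * t) + q * t := by
      simp only [p, q, s, t]; ring
    rw [hdecomp]
    have hps : |p * s| ≤ 1 := by
      rw [abs_mul]; exact mul_le_one₀ (by exact_mod_cast h1) (abs_nonneg _) (by exact_mod_cast h3)
    have hqt : |q * t| ≤ w.length := by
      rw [abs_mul]
      calc |q| * |t| ≤ 1 * (w.length : ℤ) := by
            gcongr
            exact_mod_cast h2
        _ = w.length := one_mul _
    calc _ ≤ |p * s| + |I - f (y * a.val) * t| + |q * t| := abs_add_three _ _ _
      _ ≤ 1 + (w.length : ℤ) ^ 2 + w.length := by linarith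
      _ ≤ _ := by push_cast; nlinarith [Int.natCast_nonneg w.length]

lemma integral_wedgeForm_of_zero {f g : G → ℕ} {S : Set G} (hS : ∀ x ∈ S, f x = 0) {y : G}
    {w : List (RelLetter H X)} (hw : StaysIn S y w) : (wedgeForm H X f g).integral y w = 0 := by
  induction w generalizing y with
  | nil => simp
  | cons a w ih =>
    obtain ⟨z, -, he, hz⟩ := exists_wedgeForm_onLetter_eq f g y a
    rw [EdgeForm.integral_cons, ih hw.2, he, hz (hS _ hw.1) (hS _ hw.2.left_mem)]
    simp

lemma integral_wedgeForm_of_const {f g : G → ℕ} {S : Set G} {D : ℕ}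
    (hS : ∀ x ∈ S, ∀ z, letterDist H X x z ≤ 1 → f z = D) {y : G}
    {w : List (RelLetter H X)} (hw : StaysIn S y w) :
    (wedgeForm H X f g).integral y w = D * ((g (y * wordVal w) : ℤ) - g y) := by
  induction w generalizing y with
  | nil => simp
  | cons a w ih =>
    obtain ⟨z, hz, he, -⟩ := exists_wedgeForm_onLetter_eq f g y a
    rw [EdgeForm.integral_cons, ih hw.2, he, hS y hw.1 z hz, wordVal_cons, mul_assoc]
    ring

lemma integral_wedgeForm_of_const_right {f g : G → ℕ} {S : Set G} {D : ℕ}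
    (hS : ∀ x ∈ S, g x = D) {y : G} {w : List (RelLetter H X)} (hw : StaysIn S y w) :
    (wedgeForm H X f g).integral y w = 0 := by
  induction w generalizing y with
  | nil => simp
  | cons a w ih =>
    obtain ⟨z, -, he, -⟩ := exists_wedgeForm_onLetter_eq f g y a
    rw [EdgeForm.integral_cons, ih hw.2, he, hS _ hw.1, hS _ hw.2.left_mem]
    simp

/-- A linear relative isoperimetric inequality bounds the rectangles in the relative Cayley
graph. -/
theorem exists_rectangleBound {R : Set (RelFree H X)} (hpres : IsFiniteRelPres H X R)
    (hgen : Generates H X) {A B : ℕ} (hiso : IsIsoperFn H X R fun n => A * n + B) :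
    ∃ C, RectangleBound (letterDist H X) C := by
  have hd := isGeodesicMetric_letterDist hgen
  obtain ⟨W, hWfin, hW1, hstokes⟩ := exists_stokes hpres hiso
  obtain ⟨L, hL⟩ := (hWfin.image List.length).bddAbove
  refine ⟨L ^ 2 * (A + B), ?_⟩
  intro S₁ S₂ S₃ S₄ a b c e n₁ n₂ n₃ n₄ D₁ D₂ p₁ p₂ p₃ p₄ h₁₃ h₂₄
  set f := truncDist (letterDist H X) S₁ D₁ with hf
  set g := truncDist (letterDist H X) S₂ D₂ with hg
  have hS₁ : S₁.Nonempty := ⟨a, p₁.left_mem⟩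
  have hS₂ : S₂.Nonempty := ⟨b, p₂.left_mem⟩
  obtain ⟨w₁, hl₁, hv₁, hs₁⟩ := p₁.exists_word hgen
  obtain ⟨w₂, hl₂, hv₂, hs₂⟩ := p₂.exists_word hgen
  obtain ⟨w₃, hl₃, hv₃, hs₃⟩ := p₃.exists_word hgen
  obtain ⟨w₄, hl₄, hv₄, hs₄⟩ := p₄.exists_word hgen
  have hf1 : ∀ x ∈ S₁, f x = 0 := fun x hx => truncDist_eq_zero hd D₁ hx
  have hg2 : ∀ x ∈ S₂, g x = 0 := fun x hx => truncDist_eq_zero hd D₂ hx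
  have hg4 : ∀ x ∈ S₄, g x = D₂ := fun x hx => truncDist_eq hS₂ fun s hs => h₂₄ s hs x hx
  have hf3 : ∀ x ∈ S₃, ∀ z, letterDist H X x z ≤ 1 → f z = D₁ := by
    intro x hx z hz
    refine truncDist_eq hS₁ fun s hs => ?_
    have h1 := h₁₃ s hs x hx
    have h2 := hd.tri s z x
    rw [hd.symm z x] at h2
    omega
  have hmain := hstokes (wedgeForm H X f g) (L ^ 2) ?_ a (w₁ ++ w₂) (w₄ ++ w₃) ?_
  · rw [EdgeForm.integral_append, EdgeForm.integral_append, hv₁, hv₄,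
      integral_wedgeForm_of_zero hf1 hs₁, integral_wedgeForm_of_const_right hg2 hs₂,
      integral_wedgeForm_of_const_right hg4 hs₄, integral_wedgeForm_of_const hf3 hs₃, hv₃,
      hg2 c p₂.right_mem, hg4 e p₄.right_mem] at hmain
    have hle : ((D₁ * D₂ : ℕ) : ℤ) ≤
        ((L ^ 2 * (A * ((w₁ ++ w₂).length + (w₄ ++ w₃).length) + B) : ℕ) : ℤ) := by
      refine le_trans (le_of_eq ?_) (hmain.trans (le_of_eq ?_))
      · simp
      · push_cast; rfl
    have hle' : D₁ * D₂ ≤ L ^ 2 * (A * ((w₁ ++ w₂).length + (w₄ ++ w₃).length) + B) := by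
      exact_mod_cast hle
    refine hle'.trans ?_
    rw [mul_assoc]
    refine Nat.mul_le_mul_left _ ?_
    have hlen : (w₁ ++ w₂).length + (w₄ ++ w₃).length ≤ n₁ + n₂ + n₃ + n₄ := by
      simp only [List.length_append]; omega
    calc _ ≤ A * (n₁ + n₂ + n₃ + n₄) + B := by gcongr
      _ ≤ _ := by nlinarith [Nat.zero_le (B * (n₁ + n₂ + n₃ + n₄)), Nat.zero_le A]
  · intro w hw y
    have h1 := abs_integral_wedgeForm_sub_le (H := H) (X := X) (f := f) (g := g)
      (truncDist_le_add hd hS₁ D₁) (truncDist_le_add hd hS₂ D₂) hgen y w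
    rw [hW1 w hw] at h1
    have h2 : w.length ≤ L := hL ⟨w, hw, rfl⟩
    simp only [mul_one, sub_self, mul_zero, sub_zero] at h1
    refine h1.trans ?_
    push_cast
    gcongr
  · rw [← mul_right_inj a, wordVal_append, wordVal_append, ← mul_assoc, ← mul_assoc, hv₁, hv₂, hv₄,
      hv₃]

end Rectangle

section Components

open scoped Pointwise

variable {G : Type*} [Group G] {Λ : Type*} {H : Λ → Subgroup G} {X : Set G}

/-- On the path starting at `y` and labelled by `w`, every edge labelled by `H l` whose endpoints
lie in the coset of `s` has its label in `S`. -/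
def CosetLabelsIn (l : Λ) (s : G) (S : Set G) (y : G) (w : List (RelLetter H X)) : Prop :=
  ∀ p a q, w = p ++ a :: q → a.hIndex = some l → s⁻¹ * (y * wordVal p) ∈ H l → a.val ∈ S

lemma RelLetter.val_mem {l : Λ} {a : RelLetter H X} (h : a.hIndex = some l) : a.val ∈ H l := by
  rcases a with ⟨l', h'⟩ | ⟨x, b⟩
  · obtain rfl : l' = l := by simpa [RelLetter.hIndex] using h
    exact h'.1.2
  · simp [RelLetter.hIndex] at h

lemma RelLetter.val_mem_of_hIndex_eq_none {S : Set G} (hX : X ⊆ S) (hS : S⁻¹ = S)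
    {a : RelLetter H X} (h : a.hIndex = none) : a.val ∈ S := by
  rcases a with ⟨l', h'⟩ | ⟨x, _ | _⟩
  · simp [RelLetter.hIndex] at h
  · rw [← hS]
    simpa [RelLetter.val] using hX x.2
  · simpa [RelLetter.val] using hX x.2

section CosetLabelsIn

variable {l : Λ} {s y : G} {S : Set G} {w w' : List (RelLetter H X)}

lemma CosetLabelsIn.mono {S' : Set G} (h : CosetLabelsIn l s S y w) (hS : S ⊆ S') :
    CosetLabelsIn l s S' y w :=
  fun p a q hw ha hp => hS (h p a q hw ha hp)

lemma cosetLabelsIn_nil : CosetLabelsIn l s S y ([] : List (RelLetter H X)) := by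
  intro p a q hw
  simp at hw

lemma CosetLabelsIn.head {a : RelLetter H X} (h : CosetLabelsIn l s S y (a :: w))
    (ha : a.hIndex = some l) (hy : s⁻¹ * y ∈ H l) : a.val ∈ S :=
  h [] a w rfl ha (by simpa using hy)

lemma CosetLabelsIn.tail {a : RelLetter H X} (h : CosetLabelsIn l s S y (a :: w)) :
    CosetLabelsIn l s S (y * a.val) w := by
  intro p b q hw hb hp
  exact h (a :: p) b q (by rw [hw]; rfl) hb (by simpa [mul_assoc] using hp)

lemma CosetLabelsIn.append (h : CosetLabelsIn l s S y w)
    (h' : CosetLabelsIn l s S (y * wordVal w) w') : CosetLabelsIn l s S y (w ++ w') := by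
  intro p a q hw ha hp
  rcases List.append_eq_append_iff.1 hw with ⟨r, hr, hr'⟩ | ⟨r, hr, hr'⟩
  · exact h' r a q hr' ha (by simpa [hr, mul_assoc] using hp)
  · cases r with
    | nil => exact h' [] a q (by simpa using hr'.symm) ha (by simpa [hr] using hp)
    | cons b r =>
      obtain ⟨rfl, rfl⟩ : a = b ∧ q = r ++ w' := by simpa using hr'
      exact h p a r hr ha hp

lemma cosetLabelsIn_of_forall (h : ∀ a ∈ w, a.val ∈ S) : CosetLabelsIn l s S y w := by
  rintro p a q rfl - -
  exact h a (by simp)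

/-- A short path starting far away from a coset does not meet it. -/
lemma cosetLabelsIn_of_length_lt (hgen : Generates H X) (h : w.length < letterDist H X s y) :
    CosetLabelsIn l s S y w := by
  rintro p a q rfl - hp
  have hd := isGeodesicMetric_letterDist hgen
  have h1 : letterDist H X s (y * wordVal p) ≤ 1 := letterLength_le_one_of_mem hp
  have h2 : letterDist H X y (y * wordVal p) ≤ p.length := by
    rw [letterDist_mul_right]; exact letterLength_wordVal_le p
  have h3 := hd.tri s (y * wordVal p) y
  rw [hd.symm (y * wordVal p) y] at h3
  simp at h
  omega

lemma IsGeodesicWord.of_infix (hgen : Generates H X) {u v w : List (RelLetter H X)}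
    (h : IsGeodesicWord (u ++ v ++ w)) : IsGeodesicWord v :=
  (h.append_left hgen).append_right hgen

lemma IsGeodesicWord.cosetLabelsIn_left (hgen : Generates H X) {u v : List (RelLetter H X)}
    {a : RelLetter H X} (h : IsGeodesicWord (u ++ a :: v)) (ha : a.hIndex = some l) :
    CosetLabelsIn l (y * wordVal u) S y u := by
  rintro p b q rfl - hp
  have hg : IsGeodesicWord (b :: (q ++ [a])) := by
    refine IsGeodesicWord.of_infix hgen (u := p) (w := v) ?_
    simpa using h
  have hmem : wordVal (b :: (q ++ [a])) ∈ H l := by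
    have := (H l).mul_mem ((H l).inv_mem hp) (RelLetter.val_mem ha)
    simpa [mul_assoc] using this
  have := letterLength_le_one_of_mem (X := X) hmem
  rw [hg] at this
  simp at this

lemma IsGeodesicWord.cosetLabelsIn_right (hgen : Generates H X) {u v : List (RelLetter H X)}
    {a : RelLetter H X} (h : IsGeodesicWord (u ++ a :: v)) :
    CosetLabelsIn l (y * wordVal u) S (y * wordVal u * a.val) v := by
  rintro p b q rfl hb hp
  have hg : IsGeodesicWord (a :: (p ++ [b])) := by
    refine IsGeodesicWord.of_infix hgen (u := u) (w := q) ?_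
    simpa using h
  have hmem : wordVal (a :: (p ++ [b])) ∈ H l := by
    have := (H l).mul_mem hp (RelLetter.val_mem hb)
    simpa [mul_assoc] using this
  have := letterLength_le_one_of_mem (X := X) hmem
  rw [hg] at this
  simp at this

end CosetLabelsIn

/-- The length of `g` with respect to `S`, truncated at `N`. -/
noncomputable def truncLength (S : Set G) (N : ℕ) (g : G) : ℕ := sInf {n | N ≤ n ∨ g ∈ S ^ n}

lemma truncLength_spec (S : Set G) (N : ℕ) (g : G) :
    N ≤ truncLength S N g ∨ g ∈ S ^ truncLength S N g :=
  Nat.sInf_mem (s := {n | N ≤ n ∨ g ∈ S ^ n}) ⟨N, Or.inl le_rfl⟩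

lemma truncLength_one (S : Set G) (N : ℕ) : truncLength S N 1 = 0 :=
  Nat.le_zero.1 (Nat.sInf_le (Or.inr (by simp)))

lemma truncLength_mul_le (S : Set G) (N : ℕ) (g : G) {h : G} {n : ℕ} (hh : h ∈ S ^ n) :
    truncLength S N (g * h) ≤ truncLength S N g + n := by
  refine Nat.sInf_le ?_
  rcases truncLength_spec S N g with h1 | h1
  · exact Or.inl (by omega)
  · exact Or.inr (by rw [pow_add]; exact Set.mul_mem_mul h1 hh)

lemma inv_mem_pow {S : Set G} (hS : S⁻¹ = S) {h : G} {n : ℕ} (hh : h ∈ S ^ n) : h⁻¹ ∈ S ^ n := by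
  rw [← hS, inv_pow]
  simpa using hh

lemma abs_truncLength_sub_le {S : Set G} (hS : S⁻¹ = S) (N : ℕ) (g : G) {h : G} {n : ℕ}
    (hh : h ∈ S ^ n) : |(truncLength S N (g * h) : ℤ) - truncLength S N g| ≤ n := by
  have h1 := truncLength_mul_le S N g hh
  have h2 := truncLength_mul_le S N (g * h) (inv_mem_pow hS hh)
  rw [mul_inv_cancel_right] at h2
  rw [abs_le]
  constructor <;> omega

open Classical in
/-- The derivative of the truncated length based at `s` along the coset of `s`. -/
noncomputable def cosetForm (H : Λ → Subgroup G) (X : Set G) (S : Set G) (N : ℕ) (l : Λ) (s : G) :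
    EdgeForm H X where
  onH l' y h := if l' = l ∧ s⁻¹ * y ∈ H l then
    (truncLength S N (s⁻¹ * (y * h)) : ℤ) - truncLength S N (s⁻¹ * y) else 0
  onX _ _ := 0
  add l' y h h' := by
    by_cases hl : l' = l
    · subst hl
      have : s⁻¹ * (y * h) ∈ H l' ↔ s⁻¹ * y ∈ H l' := by
        rw [← mul_assoc]
        exact Subgroup.mul_mem_cancel_right _ h.2
      by_cases hy : s⁻¹ * y ∈ H l'
      · simp [this, hy, mul_assoc]
      · simp [this, hy]
    · simp [hl]

open Classical in
lemma cosetForm_onLetter (S : Set G) (N : ℕ) (l : Λ) (s y : G) (a : RelLetter H X) :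
    (cosetForm H X S N l s).onLetter y a = if a.hIndex = some l ∧ s⁻¹ * y ∈ H l then
      (truncLength S N (s⁻¹ * y * a.val) : ℤ) - truncLength S N (s⁻¹ * y) else 0 := by
  rcases a with ⟨l', h⟩ | ⟨x, _ | _⟩
  · simp [EdgeForm.onLetter, cosetForm, RelLetter.hIndex, RelLetter.val, mul_assoc]
  · simp [EdgeForm.onLetter, cosetForm, RelLetter.hIndex]
  · simp [EdgeForm.onLetter, cosetForm, RelLetter.hIndex]

lemma abs_integral_cosetForm_le {S : Set G} (hS : S⁻¹ = S) (N : ℕ) {l : Λ} {s y : G} {n : ℕ}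
    {w : List (RelLetter H X)} (hw : CosetLabelsIn l s (S ^ n) y w) :
    |(cosetForm H X S N l s).integral y w| ≤ (w.length * n : ℕ) := by
  induction w generalizing y with
  | nil => simp
  | cons a w ih =>
    have h1 := ih hw.tail
    have h2 : |(cosetForm H X S N l s).onLetter y a| ≤ n := by
      rw [cosetForm_onLetter]
      split_ifs with h
      · exact abs_truncLength_sub_le hS N _ (hw.head h.1 h.2)
      · simp
    rw [EdgeForm.integral_cons, List.length_cons]
    refine (abs_add_le _ _).trans ?_
    push_cast at h1 ⊢
    linarith

/-- `F` bounds the labels of isolated components of loops, in terms of the length of the loop and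
of the size of the remaining labels. -/
structure ComponentBound (H : Λ → Subgroup G) (X : Set G) (S₀ : Set G) (F : ℕ → ℕ → ℕ) :
    Prop where
  finite : S₀.Finite
  subset : X ⊆ S₀
  pos : ∀ n t, 1 ≤ F n t
  val_mem : ∀ S : Set G, S₀ ⊆ S → 1 ∈ S → S⁻¹ = S →
    ∀ (l : Λ) (y : G) (u v w : List (RelLetter H X)) (a : RelLetter H X) (n t : ℕ),
      a.hIndex = some l → wordVal (u ++ a :: v) = wordVal w →
      u.length + v.length + w.length < n →
      CosetLabelsIn l (y * wordVal u) (S ^ t) y u →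
      CosetLabelsIn l (y * wordVal u) (S ^ t) (y * wordVal u * a.val) v →
      CosetLabelsIn l (y * wordVal u) (S ^ t) y w → a.val ∈ S ^ F n t

theorem exists_componentBound {R : Set (RelFree H X)} (hpres : IsFiniteRelPres H X R) {A B : ℕ}
    (hiso : IsIsoperFn H X R fun n => A * n + B) : ∃ S₀ F, ComponentBound H X S₀ F := by
  obtain ⟨W, hWfin, -, hstokes⟩ := exists_stokes hpres hiso
  obtain ⟨L, hL⟩ := (hWfin.image List.length).bddAbove
  refine ⟨X ∪ ⋃ w ∈ W, {g | g ∈ w.map RelLetter.val}, fun n t => L * (A * n + B) + n * t + 1,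
    ?_, Set.subset_union_left, fun n t => by omega, ?_⟩
  · exact hpres.finX.union (hWfin.biUnion fun w _ => List.finite_toSet _)
  intro S hS₀ h1 hS l y u v w a n t ha hval hn hu hv hw
  set T := L * (A * n + B) + n * t with hT
  set s := y * wordVal u with hs
  have hrel : ∀ r ∈ W, ∀ z, |(cosetForm H X S (T + 1) l s).integral z r| ≤ L := by
    intro r hr z
    have h2 : CosetLabelsIn l s (S ^ 1) z r := by
      refine cosetLabelsIn_of_forall fun b hb => ?_
      rw [pow_one]
      refine hS₀ (Or.inr (Set.mem_biUnion hr ?_))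
      exact List.mem_map_of_mem hb
    refine (abs_integral_cosetForm_le hS _ h2).trans ?_
    rw [mul_one]
    exact_mod_cast hL ⟨r, hr, rfl⟩
  have hmain := hstokes _ L hrel y (u ++ a :: v) w hval
  have hiu := abs_integral_cosetForm_le hS (T + 1) hu
  have hiv := abs_integral_cosetForm_le hS (T + 1) hv
  have hiw := abs_integral_cosetForm_le hS (T + 1) hw
  rw [EdgeForm.integral_append, EdgeForm.integral_cons, cosetForm_onLetter, if_pos] at hmain
  swap
  · exact ⟨ha, by simp [hs, (H l).one_mem]⟩
  rw [← hs, inv_mul_cancel, one_mul, truncLength_one] at hmain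
  have hφ : truncLength S (T + 1) a.val ≤ T := by
    have h3 : (A * ((u ++ a :: v).length + w.length) + B) ≤ A * n + B := by
      have : (u ++ a :: v).length + w.length ≤ n := by
        simp only [List.length_append, List.length_cons]; omega
      gcongr
    have h4 : u.length * t + v.length * t + w.length * t ≤ n * t := by
      rw [← add_mul, ← add_mul]
      exact Nat.mul_le_mul_right _ hn.le
    have h5 : (L : ℤ) * (A * ((u ++ a :: v).length + w.length) + B) ≤ L * (A * n + B) := by
      exact_mod_cast Nat.mul_le_mul_left L h3
    have h6 : ((u.length * t : ℕ) : ℤ) + (v.length * t : ℕ) + (w.length * t : ℕ) ≤ n * t := by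
      exact_mod_cast h4
    rw [abs_le] at hmain hiu hiv hiw
    have h7 : (T : ℤ) = L * (A * n + B) + n * t := by rw [hT]; push_cast; ring
    have h8 := hmain.2
    push_cast at h8
    zify
    rw [h7]
    linarith [hiu.1, hiv.1, hiw.2]
  rcases truncLength_spec S (T + 1) a.val with h2 | h2
  · omega
  · exact Set.pow_subset_pow_right h1 (by omega) h2

end Components

section Translation

open scoped Pointwise

variable {G : Type*} [Group G] {Λ : Type*} {H : Λ → Subgroup G} {X : Set G}

/-- The smallest symmetric set containing `S` and the identity. -/
def symmClosure (S : Set G) : Set G := insert 1 (S ∪ S⁻¹)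

lemma subset_symmClosure (S : Set G) : S ⊆ symmClosure S :=
  fun _ hx => Or.inr (Or.inl hx)

lemma one_mem_symmClosure (S : Set G) : (1 : G) ∈ symmClosure S := Or.inl rfl

lemma inv_symmClosure (S : Set G) : (symmClosure S)⁻¹ = symmClosure S := by
  simp [symmClosure, Set.union_comm]

lemma finite_symmClosure {S : Set G} (hS : S.Finite) : (symmClosure S).Finite :=
  (hS.union hS.inv).insert 1

lemma wordVal_mem_pow {S : Set G} {w : List (RelLetter H X)} (hw : ∀ a ∈ w, a.val ∈ S) :
    wordVal w ∈ S ^ w.length := by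
  induction w with
  | nil => simp
  | cons a w ih =>
    rw [wordVal_cons, List.length_cons, pow_succ']
    exact Set.mul_mem_mul (hw a (by simp)) (ih fun b hb => hw b (by simp [hb]))

lemma finite_setOf_val (w : List (RelLetter H X)) : {g | ∃ a ∈ w, RelLetter.val a = g}.Finite := by
  have : {g | ∃ a ∈ w, RelLetter.val a = g} = {g | g ∈ w.map RelLetter.val} := by ext; simp
  rw [this]
  exact List.finite_toSet _

lemma finite_pow {S : Set G} (hS : S.Finite) (n : ℕ) : (S ^ n).Finite := by
  induction n with
  | zero => simp
  | succ n ih => rw [pow_succ]; exact ih.mul hS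

lemma exists_pow_notMem {g : G} (hord : ¬ IsOfFinOrder g) {E : Set G} (hE : E.Finite) :
    ∃ n : ℕ, 1 ≤ n ∧ g ^ n ∉ E := by
  by_contra! h
  have hinj : Function.Injective fun n : ℕ => g ^ (n + 1) :=
    (injective_pow_iff_not_isOfFinOrder.2 hord).comp (add_left_injective 1)
  exact Set.infinite_range_of_injective hinj
    (hE.subset (Set.range_subset_iff.2 fun n => h (n + 1) (by omega)))

lemma exists_large_letter {S₀ : Set G} {F : ℕ → ℕ → ℕ}
    (hF : ComponentBound H X S₀ F) {S : Set G} (hS₀ : S₀ ⊆ S) (h1 : 1 ∈ S) (hS : S⁻¹ = S) {n t : ℕ}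
    {a : RelLetter H X} (ha : a.val ∉ S ^ F n t) : ∃ l, a.hIndex = some l := by
  by_contra! h
  refine ha (Set.pow_subset_pow_right h1 (hF.pos n t) ?_)
  rw [pow_one]
  exact RelLetter.val_mem_of_hIndex_eq_none (hF.subset.trans hS₀) hS
    (Option.eq_none_iff_forall_ne_some.2 h)

section Hyperbolic

variable {S₀ : Set G} {F : ℕ → ℕ → ℕ}

/-- The parabolic subgroups are closed under taking roots of infinite order. -/
lemma mem_of_pow_mem (hF : ComponentBound H X S₀ F) (hgen : Generates H X)
    {b : G} (hb : ¬ IsOfFinOrder b) {l : Λ} {r : ℕ} (hr : 0 < r)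
    (hbr : b ^ r ∈ H l) : b ∈ H l := by
  by_contra hbl
  obtain ⟨q, rfl⟩ := hgen b
  set S := symmClosure (S₀ ∪ {g | ∃ a ∈ q, RelLetter.val a = g}) with hS
  have hSfin : S.Finite := finite_symmClosure (hF.finite.union (finite_setOf_val q))
  have hqS : ∀ a ∈ q, a.val ∈ S ^ 1 := by
    intro a ha
    rw [pow_one]
    exact subset_symmClosure _ (Or.inr ⟨a, ha, rfl⟩)
  have hbr' : ¬ IsOfFinOrder (wordVal q ^ r) := by
    rw [isOfFinOrder_pow]
    simp [hb, hr.ne']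
  obtain ⟨n, hn, hnS⟩ := exists_pow_notMem hbr' (finite_pow hSfin (F (2 * q.length + 2) 1))
  have hmem : (wordVal q ^ r) ^ n ∈ H l := (H l).pow_mem hbr n
  have hne : (⟨_, hmem⟩ : H l) ≠ 1 := by
    intro h
    refine hbr' (isOfFinOrder_iff_pow_eq_one.2 ⟨n, hn, ?_⟩)
    simpa using congrArg Subtype.val h
  set a : RelLetter H X := Sum.inl ⟨l, ⟨_, hmem⟩, hne⟩ with ha
  have hav : a.val = (wordVal q ^ r) ^ n := rfl
  refine hnS (hav ▸ hF.val_mem S ((Set.subset_union_left).trans (subset_symmClosure _))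
    (one_mem_symmClosure _) (inv_symmClosure _) l 1 [] q (q ++ [a]) a _ 1 rfl ?_ ?_ ?_ ?_ ?_)
  · simp only [List.nil_append, wordVal_cons, wordVal_append, wordVal_nil, mul_one, hav]
    rw [← pow_mul, ← pow_succ, ← pow_succ']
  · simp; omega
  · exact cosetLabelsIn_nil
  · exact cosetLabelsIn_of_forall hqS
  · refine (cosetLabelsIn_of_forall hqS).append ?_
    intro p b t hp hb' hmem'
    cases p with
    | nil => exact absurd (by simpa using hmem') hbl
    | cons c p => simp at hp

/-- No nontrivial power of a hyperbolic element of infinite order is parabolic. -/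
lemma conj_pow_notMem (hF : ComponentBound H X S₀ F) (hgen : Generates H X)
    {g : G} (hg : IsHypElt H g) (hord : ¬ IsOfFinOrder g) {n : ℕ} (hn : 0 < n)
    (x : G) (l : Λ) : x⁻¹ * g ^ n * x ∉ H l := by
  intro h
  have hconj : (x⁻¹ * g * x) ^ n = x⁻¹ * g ^ n * x := by
    simpa using conj_pow (i := n) (a := x⁻¹) (b := g)
  have hmem : x⁻¹ * g * x ∈ H l := by
    refine mem_of_pow_mem hF hgen ?_ hn (hconj ▸ h)
    rw [isOfFinOrder_iff_pow_eq_one]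
    rintro ⟨k, hk, hk1⟩
    refine hord (isOfFinOrder_iff_pow_eq_one.2 ⟨k, hk, ?_⟩)
    have : (x⁻¹ * g * x) ^ k = x⁻¹ * g ^ k * x := by
      simpa using conj_pow (i := k) (a := x⁻¹) (b := g)
    rw [this] at hk1
    simpa [mul_eq_one_iff_eq_inv, mul_assoc] using hk1
  exact hg l _ hmem (isConj_iff.2 ⟨x⁻¹, by simp⟩)

/-- A long edge of a geodesic in a coset forces a translate of the geodesic to meet this coset. -/
lemma exists_coset_mem (hF : ComponentBound H X S₀ F) (hgen : Generates H X)
    {S : Set G} (hS₀ : S₀ ⊆ S) (h1 : 1 ∈ S) (hS : S⁻¹ = S) {n t : ℕ} {l : Λ}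
    {x z : G} {u v q₁ q₂ : List (RelLetter H X)} {a : RelLetter H X}
    (hu : IsGeodesicWord (u ++ a :: v)) (ha : a.hIndex = some l)
    (hq₁ : x * wordVal q₁ = z * x)
    (hq₂ : x * wordVal (u ++ a :: v) * wordVal q₂ = z * x * wordVal (u ++ a :: v))
    (hc₁ : CosetLabelsIn l (x * wordVal u) (S ^ t) x q₁)
    (hc₂ : CosetLabelsIn l (x * wordVal u) (S ^ t) (x * wordVal (u ++ a :: v)) q₂)
    (hn : 2 * (u ++ a :: v).length + q₁.length + q₂.length ≤ n) (haS : a.val ∉ S ^ F n t) :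
    ∃ p b q, u ++ a :: v = p ++ b :: q ∧
      (x * wordVal u)⁻¹ * (z * x * wordVal p) ∈ H l := by
  by_contra! hcon
  refine haS (hF.val_mem S hS₀ h1 hS l x u (v ++ q₂) (q₁ ++ (u ++ a :: v)) a n t ha ?_ ?_
    (hu.cosetLabelsIn_left hgen ha) ?_ ?_)
  · have h2 : wordVal (u ++ a :: (v ++ q₂)) = wordVal (u ++ a :: v) * wordVal q₂ := by
      simp [mul_assoc]
    rw [h2, wordVal_append q₁, ← mul_right_inj x, ← mul_assoc, ← mul_assoc, hq₂, hq₁]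
  · simp only [List.length_append, List.length_cons] at hn ⊢
    omega
  · refine (hu.cosetLabelsIn_right hgen).append ?_
    simpa [mul_assoc] using hc₂
  · refine hc₁.append ?_
    rw [hq₁]
    intro p b q hp _ hmem
    exact absurd hmem (hcon p b q hp)

/-- The translates of a geodesic by the powers of a hyperbolic element of infinite order cannot all
meet the same coset. -/
lemma exists_forall_coset_notMem (hF : ComponentBound H X S₀ F) (hgen : Generates H X)
    {g : G} (hg : IsHypElt H g) (hord : ¬ IsOfFinOrder g)
    (x s : G) (l : Λ) (u : List (RelLetter H X)) :
    ∃ i ≤ u.length, ∀ p b q, u = p ++ b :: q → s⁻¹ * (g ^ i * x * wordVal p) ∉ H l := by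
  by_contra! h
  have h' : ∀ i : Fin (u.length + 1), ∃ k : Fin u.length,
      s⁻¹ * (g ^ (i : ℕ) * x * wordVal (u.take k)) ∈ H l := by
    intro i
    obtain ⟨p, b, q, rfl, hp⟩ := h i (by omega)
    exact ⟨⟨p.length, by simp⟩, by simpa using hp⟩
  choose k hk using h'
  obtain ⟨i, j, hij, hkij⟩ := Fintype.exists_ne_map_eq_of_card_lt k (by simp)
  wlog hlt : i < j generalizing i j
  · exact this j i hij.symm hkij.symm (lt_of_le_of_ne (not_lt.1 hlt) hij.symm)
  have h2 := (H l).mul_mem ((H l).inv_mem (hk i)) (hk j)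
  rw [hkij] at h2
  refine conj_pow_notMem hF hgen hg hord (n := (j : ℕ) - i) (by omega)
    (x * wordVal (u.take (k j))) l ?_
  have h3 : g ^ (j : ℕ) = g ^ (i : ℕ) * g ^ ((j : ℕ) - i) := by
    rw [← pow_add]; congr 1; omega
  rw [h3] at h2
  simpa [mul_assoc] using h2

/-- The powers of a hyperbolic element of infinite order are unbounded. -/
theorem exists_lt_letterLength_pow (hF : ComponentBound H X S₀ F) (hgen : Generates H X)
    {g : G} (hg : IsHypElt H g) (hord : ¬ IsOfFinOrder g) (K : ℕ) :
    ∃ n : ℕ, K < letterLength H X (g ^ n) := by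
  by_contra! hK
  choose V hVg hVv using fun i : ℕ => exists_geodesicWord hgen (g ^ i)
  have hVK : ∀ i, (V i).length ≤ K := fun i => by rw [← hVg i, hVv i]; exact hK i
  set S := symmClosure (S₀ ∪ ⋃ i ∈ Set.Iic K, {y | ∃ a ∈ V i, RelLetter.val a = y}) with hSdef
  have hSfin : S.Finite := finite_symmClosure
    (hF.finite.union ((Set.finite_Iic K).biUnion fun i _ => finite_setOf_val (V i)))
  have hS₀ : S₀ ⊆ S := Set.subset_union_left.trans (subset_symmClosure _)
  have h1 : 1 ∈ S := one_mem_symmClosure _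
  have hS : S⁻¹ = S := inv_symmClosure _
  have hVS : ∀ i ≤ K, ∀ a ∈ V i, a.val ∈ S ^ 1 := by
    intro i hi a ha
    rw [pow_one]
    exact subset_symmClosure _ (Or.inr (Set.mem_biUnion hi ⟨a, ha, rfl⟩))
  set T := F (4 * K) 1
  obtain ⟨N, -, hN⟩ := exists_pow_notMem hord (finite_pow (finite_pow hSfin T) K)
  obtain ⟨a, haV, haS⟩ : ∃ a ∈ V N, a.val ∉ S ^ T := by
    by_contra! h
    refine hN (Set.pow_subset_pow_right (Set.one_mem_pow h1) (hVK N) ?_)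
    rw [← hVv N]
    exact wordVal_mem_pow h
  obtain ⟨l, hl⟩ := exists_large_letter hF hS₀ h1 hS haS
  obtain ⟨u, v, huv⟩ := List.append_of_mem haV
  have hgeod := huv ▸ hVg N
  obtain ⟨i, hi, hni⟩ := exists_forall_coset_notMem hF hgen hg hord 1 (1 * wordVal u) l (V N)
  have hiK := hi.trans (hVK N)
  obtain ⟨p, b, q, hpq, hmem⟩ := exists_coset_mem hF hgen hS₀ h1 hS (n := 4 * K) (t := 1)
    (x := 1) (z := g ^ i) (q₁ := V i) (q₂ := V i) hgeod hl (by simp [hVv])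
    (by rw [← huv, hVv, hVv]; simp [← pow_add, add_comm])
    (cosetLabelsIn_of_forall (hVS i hiK)) (cosetLabelsIn_of_forall (hVS i hiK))
    (by rw [← huv]; have := hVK N; have := hVK i; omega) haS
  exact hni p b q (huv.trans hpq) hmem

end Hyperbolic

end Translation

section Growth

open scoped Pointwise

variable {G : Type*} [Group G] {Λ : Type*} {H : Λ → Subgroup G} {X : Set G}

/-- Far from its endpoints, a geodesic is moved only slightly by an element that moves the
endpoints by a small amount and that does not translate along an axis. -/
lemma displacement_le (hgen : Generates H X) {δ : ℕ} (hδ : FourPoint (letterDist H X) δ)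
    {k b y : G} {M : ℕ} (hk : letterDist H X y (k * (k * y)) ≤ letterDist H X y (k * y) + δ)
    (ho : letterDist H X 1 (k * 1) ≤ M) (hb : letterDist H X b (k * b) ≤ M)
    (hy : letterDist H X 1 y + letterDist H X y b = letterDist H X 1 b)
    (hyo : M + 3 * δ < 2 * letterDist H X 1 y) (hyb : M + 3 * δ < 2 * letterDist H X y b) :
    letterDist H X y (k * y) ≤ 4 * δ := by
  have hd := isGeodesicMetric_letterDist hgen
  have key : ∀ e, letterDist H X e (k * e) ≤ M → M + 3 * δ < 2 * letterDist H X e y →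
      letterDist H X y (k * y) + letterDist H X e y ≤ letterDist H X e (k * y) + δ →
      letterDist H X y (k * y) ≤ 4 * δ := by
    intro e he hey h
    have h1 := hδ e (k * e) (k * y) (k * (k * y))
    have h2 : letterDist H X (k * e) (k * (k * y)) = letterDist H X e (k * y) :=
      letterDist_mul_left _ _ _
    have h3 : letterDist H X (k * y) (k * (k * y)) = letterDist H X y (k * y) :=
      letterDist_mul_left _ _ _
    have h4 : letterDist H X (k * e) (k * y) = letterDist H X e y := letterDist_mul_left _ _ _
    have h5 := hd.tri e y (k * (k * y))
    omega
  have h1 := hδ y 1 (k * y) b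
  have h2 := hd.symm y 1
  have h3 := hd.symm b y
  have h4 := hd.symm b (k * y)
  by_cases h : letterDist H X y (k * y) + letterDist H X 1 y ≤ letterDist H X 1 (k * y) + δ
  · exact key 1 ho hyo h
  · exact key b hb (by omega) (by omega)

lemma exists_append_length_eq {α : Type*} {n : ℕ} {w : List α} (h : n ≤ w.length) :
    ∃ u v, w = u ++ v ∧ u.length = n :=
  ⟨w.take n, w.drop n, (List.take_append_drop n w).symm, by simp [h]⟩

section Hyperbolic

variable {S₀ : Set G} {F : ℕ → ℕ → ℕ}

/-- If the powers of `g` move a geodesic only slightly, then the labels in the middle of the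
geodesic are bounded. -/
lemma val_mem_of_displacement_le (hF : ComponentBound H X S₀ F) (hgen : Generates H X)
    {g : G} (hg : IsHypElt H g) (hord : ¬ IsOfFinOrder g)
    {S : Set G} (hS₀ : S₀ ⊆ S) (h1 : 1 ∈ S) (hS : S⁻¹ = S) {K R : ℕ} (hKR : 2 * K + 2 ≤ R)
    {x : G} {u v w : List (RelLetter H X)} (hgeod : IsGeodesicWord (u ++ v ++ w))
    (hu : u.length = R) (hv : v.length = R) (hw : w.length = R)
    (hl : ∀ i ≤ 3 * R, letterDist H X x (g ^ i * x) ≤ K)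
    (hr : ∀ i ≤ 3 * R, letterDist H X (x * wordVal (u ++ v ++ w))
      (g ^ i * (x * wordVal (u ++ v ++ w))) ≤ K) :
    ∀ a ∈ v, a.val ∈ S ^ F (6 * R + 2 * K) 1 := by
  intro a hav
  by_contra haS
  obtain ⟨l, hl'⟩ := exists_large_letter hF hS₀ h1 hS haS
  obtain ⟨v₁, v₂, rfl⟩ := List.append_of_mem hav
  have hword : u ++ (v₁ ++ a :: v₂) ++ w = (u ++ v₁) ++ a :: (v₂ ++ w) := by simp
  have hlen : ((u ++ v₁) ++ a :: (v₂ ++ w)).length = 3 * R := by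
    rw [← hword]; simp at hv ⊢; omega
  rw [hword] at hgeod hr
  have hd := isGeodesicMetric_letterDist hgen
  obtain ⟨i, hi, hni⟩ := exists_forall_coset_notMem hF hgen hg hord x (x * wordVal (u ++ v₁)) l
    ((u ++ v₁) ++ a :: (v₂ ++ w))
  rw [hlen] at hi
  have hl := hl i hi
  have hr := hr i hi
  obtain ⟨q₁, hq₁, hv₁⟩ := exists_word_length_eq hgen (x⁻¹ * (g ^ i * x))
  obtain ⟨q₂, hq₂, hv₂⟩ := exists_word_length_eq hgen
    ((x * wordVal ((u ++ v₁) ++ a :: (v₂ ++ w)))⁻¹ *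
      (g ^ i * (x * wordVal ((u ++ v₁) ++ a :: (v₂ ++ w)))))
  have hq₁K : q₁.length ≤ K := hq₁.trans_le hl
  have hq₂K : q₂.length ≤ K := hq₂.trans_le hr
  have hd₁ : letterDist H X (x * wordVal (u ++ v₁)) x = (u ++ v₁).length := by
    rw [hd.symm, letterDist_mul_right, hgeod.append_left hgen]
  have hd₂ : letterDist H X (x * wordVal (u ++ v₁))
      (x * wordVal ((u ++ v₁) ++ a :: (v₂ ++ w))) = (a :: (v₂ ++ w)).length := by
    rw [wordVal_append (u ++ v₁), ← mul_assoc, letterDist_mul_right, hgeod.append_right hgen]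
  simp only [List.length_append, List.length_cons] at hlen hd₁ hd₂ hv
  obtain ⟨p, b, q, hpq, hmem⟩ := exists_coset_mem hF hgen hS₀ h1 hS (n := 6 * R + 2 * K) (t := 1)
    (x := x) (z := g ^ i) (q₁ := q₁) (q₂ := q₂) hgeod hl'
    (by rw [hv₁]; simp)
    (by rw [hv₂, mul_inv_cancel_left, mul_assoc])
    (cosetLabelsIn_of_length_lt hgen (by omega)) (cosetLabelsIn_of_length_lt hgen (by omega))
    (by simp only [List.length_append, List.length_cons]; omega) haS
  exact hni p b q hpq hmem

/-- An element that moves a geodesic with bounded labels only slightly is, up to conjugation,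
in a fixed finite set. -/
lemma conj_mem_of_displacement_le (hF : ComponentBound H X S₀ F) (hgen : Generates H X)
    {S : Set G} (hS₀ : S₀ ⊆ S) (h1 : 1 ∈ S) (hS : S⁻¹ = S)
    {K R t : ℕ} (hKR : 2 * K + 2 ≤ R) {x z : G} {v : List (RelLetter H X)}
    (hgeod : IsGeodesicWord v) (hv : v.length = R) (hvS : ∀ a ∈ v, a.val ∈ S ^ t)
    (hl : letterDist H X x (z * x) ≤ K)
    (hr : letterDist H X (x * wordVal v) (z * (x * wordVal v)) ≤ K) :
    x⁻¹ * (z * x) ∈ (S ^ F (2 * R + 2 * K + 1) t) ^ K := by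
  have hd := isGeodesicMetric_letterDist hgen
  obtain ⟨q, hq, hqv⟩ := exists_geodesicWord hgen (x⁻¹ * (z * x))
  obtain ⟨q', hq', hqv'⟩ :=
    exists_word_length_eq hgen ((x * wordVal v)⁻¹ * (z * (x * wordVal v)))
  have hqK : q.length ≤ K := by rw [← hq, hqv]; exact hl
  have hqK' : q'.length ≤ K := hq'.trans_le hr
  refine Set.pow_subset_pow_right (Set.one_mem_pow h1) hqK ?_
  rw [← hqv]
  refine wordVal_mem_pow fun a ha => ?_
  by_contra haS
  obtain ⟨l, hl'⟩ := exists_large_letter hF hS₀ h1 hS haS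
  obtain ⟨q₁, q₂, rfl⟩ := List.append_of_mem ha
  have hq₁ : letterDist H X x (x * wordVal q₁) ≤ q₁.length := by
    rw [letterDist_mul_right]; exact letterLength_wordVal_le q₁
  have hdv : letterDist H X x (x * wordVal v) = R := by
    rw [letterDist_mul_right, hgeod, hv]
  have htri := hd.tri x (x * wordVal q₁) (x * wordVal v)
  simp only [List.length_append, List.length_cons] at hqK
  refine haS (hF.val_mem S hS₀ h1 hS l x q₁ (q₂ ++ v) (v ++ q') a _ t hl' ?_ ?_
    (hq.cosetLabelsIn_left hgen hl') ?_ ?_)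
  · have h2 : wordVal (q₁ ++ a :: (q₂ ++ v)) = wordVal (q₁ ++ a :: q₂) * wordVal v := by
      simp [mul_assoc]
    rw [h2, hqv, wordVal_append, hqv']
    simp [mul_assoc]
  · simp only [List.length_append]; omega
  · exact (hq.cosetLabelsIn_right hgen).append (cosetLabelsIn_of_forall hvS)
  · exact (cosetLabelsIn_of_forall hvS).append (cosetLabelsIn_of_length_lt hgen (by omega))

/-- Some power of a hyperbolic element of infinite order translates along an axis. -/
theorem exists_translation (hF : ComponentBound H X S₀ F) (hgen : Generates H X)
    {g : G} (hg : IsHypElt H g) (hord : ¬ IsOfFinOrder g) {δ : ℕ}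
    (hδ : FourPoint (letterDist H X) δ) :
    ∃ (j : ℕ) (x : G), letterDist H X x (g ^ j * x) + δ <
      letterDist H X x (g ^ j * (g ^ j * x)) := by
  by_contra! hcon
  have hd := isGeodesicMetric_letterDist hgen
  set K := 4 * δ with hK
  set R := 2 * K + 2 with hR
  set S := symmClosure S₀ with hSdef
  have hSfin : S.Finite := finite_symmClosure hF.finite
  have hS₀ : S₀ ⊆ S := subset_symmClosure _
  have h1 : 1 ∈ S := one_mem_symmClosure _
  have hS : S⁻¹ = S := inv_symmClosure _
  set T := F (6 * R + 2 * K) 1 with hT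
  set E := (S ^ F (2 * R + 2 * K + 1) T) ^ K with hE
  have hEfin : E.Finite := finite_pow (finite_pow hSfin _) _
  set I := max (3 * R) (hEfin.toFinset.card) with hI
  obtain ⟨M, hM⟩ := ((Set.finite_Iic I).image fun i : ℕ => letterLength H X (g ^ i)).bddAbove
  have hM' : ∀ i ≤ I, letterLength H X (g ^ i) ≤ M := fun i hi => hM ⟨i, hi, rfl⟩
  set s := M + 3 * δ + 1 with hs
  obtain ⟨N, hN⟩ := exists_lt_letterLength_pow hF hgen hg hord (2 * s + 3 * R)
  obtain ⟨w, hw, hwv⟩ := exists_geodesicWord hgen (g ^ N)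
  have hwl : 2 * s + 3 * R < w.length := by rw [← hw, hwv]; exact hN
  have hdisp : ∀ p q, w = p ++ q → s ≤ p.length → s ≤ q.length → ∀ i ≤ I,
      letterDist H X (wordVal p) (g ^ i * wordVal p) ≤ K := by
    rintro p q rfl hp hq i hi
    have hp' : letterDist H X 1 (wordVal p) = p.length := by
      rw [letterDist, inv_one, one_mul]
      exact hw.append_left hgen
    have hq' : letterDist H X (wordVal p) (g ^ N) = q.length := by
      rw [← hwv, wordVal_append, letterDist_mul_right]
      exact hw.append_right hgen
    have hpq' : letterDist H X 1 (g ^ N) = p.length + q.length := by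
      rw [← hwv, ← List.length_append, letterDist, inv_one, one_mul]
      exact hw
    refine displacement_le hgen hδ (b := g ^ N) (M := M) (hcon i _) ?_ ?_ ?_ ?_ ?_
    · simpa [letterDist] using hM' i hi
    · have : (g ^ N)⁻¹ * (g ^ i * g ^ N) = g ^ i := by
        rw [← pow_add, add_comm, pow_add, inv_mul_cancel_left]
      rw [letterDist, this]
      exact hM' i hi
    · omega
    · omega
    · omega
  obtain ⟨w₀, w', rfl, hw₀⟩ := exists_append_length_eq (n := s) (w := w) (by omega)
  simp only [List.length_append] at hwl
  obtain ⟨a, w', rfl, ha⟩ := exists_append_length_eq (n := R) (w := w') (by omega)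
  simp only [List.length_append] at hwl
  obtain ⟨b, w', rfl, hb⟩ := exists_append_length_eq (n := R) (w := w') (by omega)
  simp only [List.length_append] at hwl
  obtain ⟨c, w₃, rfl, hc⟩ := exists_append_length_eq (n := R) (w := w') (by omega)
  simp only [List.length_append] at hwl
  have hgeod : IsGeodesicWord (a ++ b ++ c) :=
    IsGeodesicWord.of_infix hgen (u := w₀) (w := w₃) (by simpa using hw)
  have hbT : ∀ y ∈ b, y.val ∈ S ^ T := by
    refine val_mem_of_displacement_le hF hgen hg hord hS₀ h1 hS (K := K) hR.ge
      (x := wordVal w₀) hgeod ha hb hc (fun i hi => ?_) (fun i hi => ?_)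
    · exact hdisp w₀ _ rfl hw₀.ge (by simp only [List.length_append]; omega) i
        (hi.trans (le_max_left _ _))
    · have := hdisp (w₀ ++ (a ++ b ++ c)) w₃ (by simp)
        (by simp only [List.length_append]; omega) (by omega) i (hi.trans (le_max_left _ _))
      rwa [wordVal_append w₀] at this
  have hmaps : ∀ i ∈ Finset.range (hEfin.toFinset.card + 1),
      (wordVal (w₀ ++ a))⁻¹ * (g ^ i * wordVal (w₀ ++ a)) ∈ hEfin.toFinset := by
    intro i hi
    have hiI : i ≤ I := by rw [Finset.mem_range] at hi; omega
    rw [Set.Finite.mem_toFinset]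
    refine conj_mem_of_displacement_le hF hgen hS₀ h1 hS (K := K) hR.ge (v := b) ?_ hb hbT ?_ ?_
    · exact hgeod.of_infix hgen
    · exact hdisp (w₀ ++ a) (b ++ (c ++ w₃)) (by simp) (by simp only [List.length_append]; omega)
        (by simp only [List.length_append]; omega) i hiI
    · have := hdisp (w₀ ++ a ++ b) (c ++ w₃) (by simp) (by simp only [List.length_append]; omega)
        (by simp only [List.length_append]; omega) i hiI
      rwa [wordVal_append (w₀ ++ a)] at this
  obtain ⟨i, -, i', -, hne, heq⟩ := Finset.exists_ne_map_eq_of_card_lt_of_maps_to (by simp) hmaps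
  refine hne (injective_pow_iff_not_isOfFinOrder.2 hord ?_)
  simpa using heq

/-- The relative length of the powers of a hyperbolic element of infinite order grows linearly. -/
theorem exists_le_letterLength_pow (hF : ComponentBound H X S₀ F) (hgen : Generates H X)
    {g : G} (hg : IsHypElt H g) (hord : ¬ IsOfFinOrder g) {δ : ℕ}
    (hδ : FourPoint (letterDist H X) δ) :
    ∃ j c : ℕ, ∀ n : ℕ, n ≤ j * letterLength H X (g ^ n) + c := by
  obtain ⟨j, x, hjx⟩ := exists_translation hF hgen hg hord hδ
  have hd := isGeodesicMetric_letterDist hgen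
  have hj : 0 < j := by
    rcases Nat.eq_zero_or_pos j with rfl | hj
    · simp at hjx
    · exact hj
  set h := g ^ j with hh
  have hgrow : ∀ n, letterDist H X x (h ^ n * (h * x)) <
      letterDist H X x (h ^ (n + 1) * (h * x)) := by
    intro n
    induction n with
    | zero => simpa using (Nat.le_add_right _ δ).trans_lt hjx
    | succ n ih =>
      have h1 := hδ x (h * x) (h * (h * x)) (h ^ (n + 1 + 1) * (h * x))
      have h2 : letterDist H X (h * x) (h ^ (n + 1 + 1) * (h * x)) =
          letterDist H X x (h ^ (n + 1) * (h * x)) := by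
        rw [pow_succ' h (n + 1), mul_assoc, letterDist_mul_left]
      have h3 : letterDist H X (h * (h * x)) (h ^ (n + 1 + 1) * (h * x)) =
          letterDist H X x (h ^ n * (h * x)) := by
        rw [pow_succ' h (n + 1), pow_succ' h n, mul_assoc, mul_assoc, letterDist_mul_left,
          letterDist_mul_left]
      have h4 : letterDist H X (h * x) (h * (h * x)) = letterDist H X x (h * x) :=
        letterDist_mul_left _ _ _
      rw [h2, h3, h4] at h1
      omega
  have hlin : ∀ n, n ≤ letterDist H X x (h ^ n * (h * x)) := by
    intro n
    induction n with
    | zero => omega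
    | succ n ih => have := hgrow n; omega
  have hlin' : ∀ n, n ≤ letterLength H X (h ^ n) + letterLength H X (x⁻¹) +
      letterLength H X (h * x) := by
    intro n
    refine (hlin n).trans ?_
    have h1 := letterLength_mul_le hgen (x⁻¹) (h ^ n * (h * x))
    have h2 := letterLength_mul_le hgen (h ^ n) (h * x)
    rw [letterDist]
    omega
  obtain ⟨M, hM⟩ := ((Set.finite_Iic j).image fun i : ℕ => letterLength H X (g ^ i)⁻¹).bddAbove
  refine ⟨j, j * (M + letterLength H X (x⁻¹) + letterLength H X (h * x) + 1), fun n => ?_⟩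
  have h1 := hlin' (n / j)
  have h2 : letterLength H X (h ^ (n / j)) ≤ letterLength H X (g ^ n) + M := by
    have h3 : h ^ (n / j) = g ^ n * (g ^ (n % j))⁻¹ := by
      rw [eq_mul_inv_iff_mul_eq, hh, ← pow_mul, ← pow_add, Nat.div_add_mod]
    rw [h3]
    refine (letterLength_mul_le hgen _ _).trans ?_
    have : letterLength H X (g ^ (n % j))⁻¹ ≤ M := hM ⟨n % j, (Nat.mod_lt n hj).le, rfl⟩
    omega
  have h3 := Nat.lt_mul_div_succ n hj
  rw [← mul_add]
  refine h3.le.trans (Nat.mul_le_mul_left j ?_)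
  omega

end Hyperbolic

end Growth

section Conclusion

variable {G : Type*} [Group G] {Λ : Type*} {H : Λ → Subgroup G} {X : Set G}

lemma generates_of_isFiniteRelPres {R : Set (RelFree H X)} (hpres : IsFiniteRelPres H X R) :
    Generates H X := by
  intro g
  obtain ⟨f, rfl⟩ := hpres.surj g
  obtain ⟨w, rfl⟩ := exists_wordToF_eq f
  exact ⟨w, (relEps_wordToF w).symm⟩

lemma exists_wordLength_eq {S : Set G} (hS : Subgroup.closure S = ⊤) (g : G) :
    ∃ w : List G, w.length = wordLength S g ∧ (∀ x ∈ w, x ∈ S ∨ x⁻¹ ∈ S) ∧ w.prod = g := by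
  have hg : g ∈ (Subgroup.closure S).toSubmonoid := by rw [hS]; trivial
  rw [Subgroup.closure_toSubmonoid] at hg
  obtain ⟨w, hw, hwg⟩ := Submonoid.exists_list_of_mem_closure hg
  exact Nat.sInf_mem
    (s := {n | ∃ w : List G, w.length = n ∧ (∀ x ∈ w, x ∈ S ∨ x⁻¹ ∈ S) ∧ w.prod = g})
    ⟨_, w, rfl, hw, hwg⟩

lemma exists_letterLength_le_relLen (hgen : Generates H X) {Y : Set G} (hY : Y.Finite)
    (hYgen : Subgroup.closure Y = ⊤) :
    ∃ κ : ℕ, ∀ g, letterLength H X g ≤ κ * relLen H Y g := by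
  obtain ⟨M, hM⟩ := (hY.image (letterLength H X)).bddAbove
  refine ⟨M + 1, fun g => ?_⟩
  have hone : ∀ x ∈ Y ∪ ⋃ l, (H l : Set G), letterLength H X x ≤ M + 1 := by
    rintro x (hx | hx)
    · exact (hM ⟨x, hx, rfl⟩).trans (Nat.le_succ M)
    · obtain ⟨l, hl⟩ := Set.mem_iUnion.1 hx
      exact (letterLength_le_one_of_mem hl).trans (by omega)
  have hle : ∀ w : List G, (∀ x ∈ w, x ∈ Y ∪ (⋃ l, (H l : Set G)) ∨ x⁻¹ ∈ Y ∪ ⋃ l, (H l : Set G)) →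
      letterLength H X w.prod ≤ (M + 1) * w.length := by
    intro w hw
    induction w with
    | nil => simp [letterLength_one]
    | cons x w ih =>
      have h1 := ih fun y hy => hw y (List.mem_cons_of_mem _ hy)
      have h2 : letterLength H X x ≤ M + 1 := by
        rcases hw x List.mem_cons_self with h | h
        · exact hone x h
        · rw [← letterLength_inv hgen]; exact hone _ h
      rw [List.prod_cons, List.length_cons, mul_add, mul_one]
      exact (letterLength_mul_le hgen _ _).trans (by omega)
  have htop : Subgroup.closure (Y ∪ ⋃ l, (H l : Set G)) = ⊤ :=
    top_le_iff.1 (hYgen ▸ Subgroup.closure_mono Set.subset_union_left)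
  obtain ⟨w, hlen, hw, rfl⟩ := exists_wordLength_eq htop g
  rw [relLen, ← hlen]
  exact hle w hw

lemma letterLength_zpow (hgen : Generates H X) (g : G) (n : ℤ) :
    letterLength H X (g ^ n) = letterLength H X (g ^ n.natAbs) := by
  rcases Int.natAbs_eq n with h | h
  · conv_lhs => rw [h, zpow_natCast]
  · conv_lhs => rw [h, zpow_neg, zpow_natCast, letterLength_inv hgen]

/-- If the powers of `g` grow linearly, then powers of `g` with exponents of different absolute
values are not conjugate. -/
lemma natAbs_eq_of_isConj_zpow (hgen : Generates H X) {g : G} {j c : ℕ}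
    (hlin : ∀ n : ℕ, n ≤ j * letterLength H X (g ^ n) + c) {k l : ℤ}
    (hkl : IsConj (g ^ k) (g ^ l)) : k.natAbs = l.natAbs := by
  obtain ⟨t, ht⟩ := isConj_iff.1 hkl
  set a : ℕ → ℝ := fun n => letterLength H X (g ^ n) with ha
  have hsub : Subadditive a := by
    intro m n
    simp only [ha, pow_add]
    exact_mod_cast letterLength_mul_le hgen _ _
  have hbdd : BddBelow (Set.range fun n => a n / n) :=
    ⟨0, by rintro _ ⟨n, rfl⟩; positivity⟩
  have htend := hsub.tendsto_lim hbdd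
  set τ := hsub.lim
  have hpos : τ ≠ 0 := by
    intro h0
    rw [h0] at htend
    have h1 : Filter.Tendsto (fun n : ℕ => j * (a n / n) + c / n) Filter.atTop (nhds 0) := by
      simpa using (htend.const_mul (j : ℝ)).add (tendsto_const_div_atTop_nhds_zero_nat (c : ℝ))
    have h2 : (1 : ℝ) ≤ 0 := by
      refine ge_of_tendsto h1 ?_
      filter_upwards [Filter.eventually_gt_atTop 0] with n hn
      have hn' : (0 : ℝ) < n := by exact_mod_cast hn
      rw [← mul_div_assoc, ← add_div, le_div_iff₀ hn', one_mul]
      simp only [ha]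
      exact_mod_cast hlin n
    linarith
  have hscale : ∀ k : ℕ, Filter.Tendsto (fun n : ℕ => a (k * n) / n)
      Filter.atTop (nhds (k * τ)) := by
    intro k
    rcases Nat.eq_zero_or_pos k with rfl | hk
    · simp [ha, letterLength_one]
    · have h1 := (htend.comp (Filter.tendsto_id.const_mul_atTop' hk)).const_mul (k : ℝ)
      refine h1.congr fun n => ?_
      have hk' : (k : ℝ) ≠ 0 := by exact_mod_cast hk.ne'
      simp only [Function.comp, id]
      push_cast
      rw [← mul_div_assoc, mul_div_mul_left _ _ hk']
  have hle : ∀ k l : ℤ, ∀ t : G, t * g ^ k * t⁻¹ = g ^ l → (l.natAbs : ℝ) * τ ≤ k.natAbs * τ := by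
    intro k l t ht
    have h1 : Filter.Tendsto (fun n : ℕ => a (k.natAbs * n) / n + 2 * letterLength H X t / n)
        Filter.atTop (nhds (k.natAbs * τ)) := by
      simpa using (hscale k.natAbs).add
        (tendsto_const_div_atTop_nhds_zero_nat (2 * letterLength H X t : ℝ))
    refine le_of_tendsto_of_tendsto' (hscale l.natAbs) h1 fun n => ?_
    rw [← add_div]
    have h2 : ∀ k : ℤ, letterLength H X (g ^ (k.natAbs * n)) = letterLength H X ((g ^ k) ^ n) := by
      intro k
      rw [← zpow_natCast (g ^ k), ← zpow_mul, letterLength_zpow hgen, Int.natAbs_mul,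
        Int.natAbs_natCast]
    have h3 : letterLength H X (g ^ (l.natAbs * n)) ≤
        letterLength H X (g ^ (k.natAbs * n)) + 2 * letterLength H X t := by
      rw [h2, h2, ← ht, conj_pow]
      have h4 := letterLength_mul_le hgen (t * (g ^ k) ^ n) t⁻¹
      have h5 := letterLength_mul_le hgen t ((g ^ k) ^ n)
      rw [letterLength_inv hgen] at h4
      omega
    gcongr
    simp only [ha]
    exact_mod_cast h3
  have heq := (hle k l t ht).antisymm (hle l k t⁻¹ (by rw [← ht]; group))
  exact_mod_cast (mul_right_cancel₀ hpos heq).symm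

end Conclusion

end RelHyp

open RelHyp

/-- Theorem 1.16 / Corollary 4.20–4.21. Let `G` be generated by a finite set
`X` and hyperbolic relative to `{H₁,…,H_m}`, and let `g ∈ G` be a hyperbolic element of
infinite order. Then there are `λ > 0`, `c ≥ 0` with `|gⁿ|_{X∪𝓗} ≥ λ|n| − c` for all `n ∈ ℤ`
(so `⟨g⟩` is quasi-isometrically embedded in `(G, dist_{X∪𝓗})`); consequently, if `g^k` is
conjugate to `g^l` then `k = ±l`. -/
theorem statement_19 {G : Type*} [Group G] {m : ℕ} (H : Fin m → Subgroup G)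
    (X : Set G) (hXfin : X.Finite) (hXgen : Subgroup.closure X = ⊤)
    (hhyp : IsRelHyperbolic H) (g : G) (hg : IsHypElt H g) (hord : ¬ IsOfFinOrder g) :
    (∃ lam c : ℝ, 0 < lam ∧ 0 ≤ c ∧
        ∀ n : ℤ, lam * |(n : ℝ)| - c ≤ (relLen H X (g ^ n) : ℝ)) ∧
    ∀ k l : ℤ, IsConj (g ^ k) (g ^ l) → k = l ∨ k = -l := by
  obtain ⟨Y, R, hpres, A, B, hiso⟩ := hhyp
  have hgen := generates_of_isFiniteRelPres hpres
  obtain ⟨C, hC⟩ := exists_rectangleBound hpres hgen hiso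
  have hδ := fourPoint_of_rectangleBound (isGeodesicMetric_letterDist hgen) hC
  obtain ⟨S₀, F, hF⟩ := exists_componentBound hpres hiso
  obtain ⟨j, c, hlin⟩ := exists_le_letterLength_pow hF hgen hg hord hδ
  refine ⟨?_, fun k l hkl => Int.natAbs_eq_natAbs_iff.1 (natAbs_eq_of_isConj_zpow hgen hlin hkl)⟩
  obtain ⟨κ, hκ⟩ := exists_letterLength_le_relLen hgen hXfin hXgen
  have hpos : (0 : ℝ) < j * κ + 1 := by positivity
  refine ⟨(j * κ + 1 : ℝ)⁻¹, (j * κ + 1 : ℝ)⁻¹ * c, by positivity, by positivity, fun n => ?_⟩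
  rw [← mul_sub, inv_mul_le_iff₀ hpos, sub_le_iff_le_add]
  have h1 := hlin n.natAbs
  rw [← letterLength_zpow hgen] at h1
  have h2 : n.natAbs ≤ (j * κ + 1) * relLen H X (g ^ n) + c := by
    have := Nat.mul_le_mul_left j (hκ (g ^ n))
    nlinarith
  rw [← Int.cast_abs, Int.abs_eq_natAbs, Int.cast_natCast]
  exact_mod_cast h2
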